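/- Let p^(1), p^(2), q^(1), q^(2) be probability vectors on n points such that p^(2) and q^(2) have full support and p^(1) ≠ p^(2). Then the following are equivalent: (i) for every real α ≥ 1/2, D_α(p^(1)‖p^(2)) ≥ D_α(q^(1)‖q^(2)) and D_α(p^(2)‖p^(1)) ≥ D_α(q^(2)‖q^(1)) (inequalities in [0,∞]); (ii) for every ε > 0 there exist a stochastic matrix T_ε and dichotomies (q_ε^(1), q_ε^(2)) and (r_ε^(1), r_ε^(2)) with ‖q^(k) − q_ε^(k)‖₁ ≤ ε and T_ε(r_ε^(k) ⊗ p^(k)) = r_ε^(k) ⊗ q_ε^(k) for k = 1, 2 (and one may take r_ε^(k) = (1/(n+1)) ⊕_{ℓ=0}^{n} (q_ε^(k))^{⊗ℓ} ⊗ (p^(k))^{⊗(n−ℓ)} for n sufficiently large); (iii) for every ε > 0 there is a dichotomy (q_ε^(1), q_ε^(2)) of probability vectors on n points with ‖q^(k) − q_ε^(k)‖₁ ≤ ε for k = 1, 2, such that for all sufficiently large m there is a stochastic matrix T_{ε,m} with T_{ε,m}(p^(k))^{⊗m} = (q_ε^(k))^{⊗m} for k = 1, 2. Moreover, in (ii)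 and (iii) one may additionally take q_ε^(2) = q^(2) for all ε > 0. -/

import Mathlib

open Classical

noncomputable section

/-- `p` is a probability vector. -/
def IsProb {I : Type} [Fintype I] (p : I → ℝ) : Prop :=
  (∀ x, 0 ≤ p x) ∧ ∑ x, p x = 1

/-- `T` is a (column-)stochastic matrix (`T y x` is the entry in row `y`, column `x`). -/
def IsStoch {I J : Type} [Fintype I] [Fintype J] (T : J → I → ℝ) : Prop :=
  (∀ y x, 0 ≤ T y x) ∧ ∀ x, ∑ y, T y x = 1

/-- Kronecker product of two vectors. -/
def kron {I J : Type} (p : I → ℝ) (q : J → ℝ) : I × J → ℝ := fun x => p x.1 * q x.2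

/-- `n`-fold Kronecker power `p^{⊗n}`. -/
def kpow {I : Type} (p : I → ℝ) (n : ℕ) : (Fin n → I) → ℝ := fun f => ∏ j, p (f j)

/-- Index type of the catalyst `⊕_{ℓ=0}^{n} (q)^{⊗ℓ} ⊗ (p)^{⊗(n-ℓ)}`
(`I` indexes `p`, `J` indexes `q`). -/
abbrev CatIdx (I J : Type) (n : ℕ) : Type :=
  (ℓ : Fin (n + 1)) × ((Fin (ℓ : ℕ) → J) × (Fin (n - (ℓ : ℕ)) → I))

/-- The catalyst `r = (1/(n+1)) ⊕_{ℓ=0}^{n} q^{⊗ℓ} ⊗ p^{⊗(n-ℓ)}`. -/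
def catVec {I J : Type} (n : ℕ) (p : I → ℝ) (q : J → ℝ) : CatIdx I J n → ℝ :=
  fun x => (1 / (n + 1 : ℝ)) * ((∏ j, q (x.2.1 j)) * ∏ j, p (x.2.2 j))

/-- The multivariate monotone `Φ_{α,C}` (convention `0^0 = 1` of `rpow`). -/
def phiAC {I : Type} [Fintype I] (d : ℕ) (α : Fin d → ℝ) (C : Finset (Fin d))
    (p : Fin d → I → ℝ) : ℝ :=
  ∑ x ∈ Finset.univ.filter (fun x => ∀ c ∈ C, p c x ≠ 0), ∏ k, p k x ^ α k

/-- The standard basis vector `e_k` of `ℝ^d`. -/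
def stdBasis (d : ℕ) (k : Fin d) : Fin d → ℝ := fun j => if j = k then 1 else 0

/-- ℓ¹-distance of vectors. -/
def dist1 {I : Type} [Fintype I] (p q : I → ℝ) : ℝ := ∑ x, |p x - q x|

/-- A dichotomy: a pair of probability vectors with `supp p ⊆ supp q`. -/
def IsDichotomy {I : Type} [Fintype I] (p q : I → ℝ) : Prop :=
  IsProb p ∧ IsProb q ∧ ∀ x, p x ≠ 0 → q x ≠ 0

/-- The Rényi divergence `D_α(p‖q)` for `α ∈ [0,∞)`, with values in `EReal`
(`⊤` encodes `+∞`; all divergences are `⊤` if `supp p ∩ supp q = ∅`). -/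
def renyi {I : Type} [Fintype I] (α : ℝ) (p q : I → ℝ) : EReal :=
  if ¬ ∃ x, p x ≠ 0 ∧ q x ≠ 0 then ⊤
  else if α = 0 then
    ((-Real.log (∑ x ∈ Finset.univ.filter (fun x => p x ≠ 0 ∧ q x ≠ 0), q x) : ℝ) : EReal)
  else if α < 1 then
    (((α - 1)⁻¹ * Real.log (∑ x ∈ Finset.univ.filter (fun x => p x ≠ 0 ∧ q x ≠ 0),
        p x ^ α * q x ^ (1 - α)) : ℝ) : EReal)
  else if α = 1 then
    if ∀ x, p x ≠ 0 → q x ≠ 0 then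
      ((∑ x ∈ Finset.univ.filter (fun x => p x ≠ 0), p x * Real.log (p x / q x) : ℝ) : EReal)
    else ⊤
  else
    if ∀ x, p x ≠ 0 → q x ≠ 0 then
      (((α - 1)⁻¹ * Real.log (∑ x ∈ Finset.univ.filter (fun x => p x ≠ 0),
          p x ^ α * q x ^ (1 - α)) : ℝ) : EReal)
    else ⊤

/-- The max divergence `D_∞(p‖q)`, with values in `EReal`. -/
def renyiTop {I : Type} [Fintype I] (p q : I → ℝ) : EReal :=
  if h : ∃ x, p x ≠ 0 ∧ q x ≠ 0 then
    if ∀ x, p x ≠ 0 → q x ≠ 0 then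
      ((Real.log ((Finset.univ.filter fun x => p x ≠ 0).sup'
        ⟨h.choose, Finset.mem_filter.mpr ⟨Finset.mem_univ _, h.choose_spec.1⟩⟩
        fun x => p x / q x) : ℝ) : EReal)
    else ⊤
  else ⊤

/-- Approximate catalytic majorization of the dichotomy `(q₁,q₂)` by `(p₁,p₂)` with
vanishing error, where the approximants' second member must satisfy `extra`; includes
the claim that the explicit binomial catalyst works for all large `n`. -/
def CondCat {I J : Type} [Fintype I] [Fintype J]
    (p₁ p₂ : I → ℝ) (q₁ q₂ : J → ℝ) (extra : (J → ℝ) → Prop) : Prop :=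
  ∀ ε : ℝ, 0 < ε → ∃ qe₁ qe₂ : J → ℝ, IsDichotomy qe₁ qe₂ ∧
    dist1 q₁ qe₁ ≤ ε ∧ dist1 q₂ qe₂ ≤ ε ∧ extra qe₂ ∧
    (∃ (R : Type) (_ : Fintype R) (r₁ r₂ : R → ℝ), IsDichotomy r₁ r₂ ∧
      ∃ T : R × J → R × I → ℝ, IsStoch T ∧
        (∀ y, ∑ x, T y x * kron r₁ p₁ x = kron r₁ qe₁ y) ∧
        (∀ y, ∑ x, T y x * kron r₂ p₂ x = kron r₂ qe₂ y)) ∧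
    (∃ N : ℕ, ∀ n ≥ N,
      ∃ T : CatIdx I J n × J → CatIdx I J n × I → ℝ, IsStoch T ∧
        (∀ y, ∑ x, T y x * kron (catVec n p₁ qe₁) p₁ x = kron (catVec n p₁ qe₁) qe₁ y) ∧
        (∀ y, ∑ x, T y x * kron (catVec n p₂ qe₂) p₂ x = kron (catVec n p₂ qe₂) qe₂ y))

/-- Approximate large-sample majorization of the dichotomy `(q₁,q₂)` by `(p₁,p₂)` with
vanishing error, where the approximants' second member must satisfy `extra`. -/
def CondLS {I J : Type} [Fintype I] [Fintype J]
    (p₁ p₂ : I → ℝ) (q₁ q₂ : J → ℝ) (extra : (J → ℝ) → Prop) : Prop :=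
  ∀ ε : ℝ, 0 < ε → ∃ qe₁ qe₂ : J → ℝ, IsDichotomy qe₁ qe₂ ∧
    dist1 q₁ qe₁ ≤ ε ∧ dist1 q₂ qe₂ ≤ ε ∧ extra qe₂ ∧
    ∃ N : ℕ, ∀ n ≥ N,
      ∃ T : (Fin n → J) → (Fin n → I) → ℝ, IsStoch T ∧
        (∀ g, ∑ f, T g f * kpow p₁ n f = kpow qe₁ n g) ∧
        (∀ g, ∑ f, T g f * kpow p₂ n f = kpow qe₂ n g)

section Helpers

open Filter Topology

/-- A class of functions containing the affine ones and closed under adding nonnegative multiples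
of hinge functions interpolates a convex function at any finite set of points. -/
theorem exists_hinge_interpolation {G : (ℝ → ℝ) → Prop} (haff : ∀ A B, G (fun r => A * r + B))
    (hadd : ∀ g w t, G g → 0 ≤ w → G (fun r => g r + w * max 0 (r - t)))
    {h : ℝ → ℝ} (hc : ConvexOn ℝ Set.univ h) {A₀ B₀ m₀ : ℝ} (h₀ : ∀ r, A₀ * r + B₀ ≤ h r)
    (h₀' : A₀ * m₀ + B₀ = h m₀) (R : Finset ℝ) (hR : ∀ r ∈ R, m₀ < r) :
    ∃ g, G g ∧ ∀ r ∈ R, g r = h r := by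
  suffices H : ∃ g M k, G g ∧ (∀ r ∈ R, g r = h r ∧ r ≤ M) ∧ M ∈ insert m₀ R ∧
      ∀ r, M ≤ r → g r = h M + k * (r - M) ∧ g r ≤ h r by
    obtain ⟨g, M, k, hg, hgR, -⟩ := H
    exact ⟨g, hg, fun r hr => (hgR r hr).1⟩
  induction R using Finset.induction_on_max with
  | empty =>
    refine ⟨_, m₀, A₀, haff A₀ B₀, by simp, by simp, fun r _ => ⟨?_, h₀ r⟩⟩
    rw [← h₀']; ring
  | insert s R hs ih =>
    obtain ⟨g, M, k, hg, hgR, hM, hgM⟩ := ih fun r hr => hR r (Finset.mem_insert_of_mem hr)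
    have hMs : M < s := by
      rcases Finset.mem_insert.1 hM with rfl | hM
      · exact hR s (Finset.mem_insert_self _ _)
      · exact hs M hM
    have hpos : 0 < s - M := sub_pos.2 hMs
    refine ⟨_, s, (h s - h M) / (s - M),
      hadd g ((h s - g s) / (s - M)) M hg (div_nonneg (sub_nonneg.2 (hgM s hMs.le).2) hpos.le),
      ?_, Finset.mem_insert_of_mem (Finset.mem_insert_self _ _), ?_⟩
    · intro r hr
      rcases Finset.mem_insert.1 hr with rfl | hr
      · refine ⟨?_, le_rfl⟩
        rw [max_eq_right hpos.le]; field_simp; ring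
      · refine ⟨?_, (hs r hr).le⟩
        rw [max_eq_left (sub_nonpos.2 (hgR r hr).2), (hgR r hr).1]; ring
    · intro r hr
      have e : g r + (h s - g s) / (s - M) * max 0 (r - M) =
          h s + (h s - h M) / (s - M) * (r - s) := by
        rw [max_eq_right (by linarith), (hgM r (by linarith)).1, (hgM s hMs.le).1]
        field_simp; ring
      refine ⟨e, ?_⟩
      rw [e]
      rcases hr.eq_or_lt with rfl | hr
      · simp
      · have := hc.slope_mono_adjacent (Set.mem_univ M) (Set.mem_univ r) hMs hr
        rw [le_div_iff₀ (sub_pos.2 hr)] at this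
        linarith

theorem sum_sup_affine_le {I J K : Type} [Fintype I] [Fintype J] {a b : I → ℝ} {c d : J → ℝ}
    (ha : IsProb a) (hb : IsProb b) (hc : IsProb c) (hd : IsProb d)
    (hb0 : ∀ x, 0 < b x) (hd0 : ∀ y, 0 < d y)
    (H : ∀ t > 0, ∑ y, max 0 (c y - t * d y) ≤ ∑ x, max 0 (a x - t * b x))
    (s : Finset K) (hs : s.Nonempty) (α γ : K → ℝ) :
    ∑ y, d y * s.sup' hs (fun k => α k * (c y / d y) + γ k) ≤
      ∑ x, b x * s.sup' hs (fun k => α k * (a x / b x) + γ k) := by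
  set h : ℝ → ℝ := fun r => s.sup' hs (fun k => α k * r + γ k) with hh
  have hconv : ConvexOn ℝ Set.univ h := by
    refine ⟨convex_univ, fun x _ y _ u v hu hv huv => ?_⟩
    refine Finset.sup'_le _ _ fun k hk => ?_
    have h1 : α k * x + γ k ≤ h x := Finset.le_sup' (fun k => α k * x + γ k) hk
    have h2 : α k * y + γ k ≤ h y := Finset.le_sup' (fun k => α k * y + γ k) hk
    simp only [smul_eq_mul]
    calc α k * (u * x + v * y) + γ k = u * (α k * x + γ k) + v * (α k * y + γ k) := by
          linear_combination (-γ k) * huv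
      _ ≤ _ := add_le_add (mul_le_mul_of_nonneg_left h1 hu) (mul_le_mul_of_nonneg_left h2 hv)
  obtain ⟨k, hk, hk'⟩ := Finset.exists_mem_eq_sup' hs (fun k => α k * (-1) + γ k)
  let G : (ℝ → ℝ) → Prop := fun g => ∑ y, d y * g (c y / d y) ≤ ∑ x, b x * g (a x / b x)
  have haff : ∀ A B, G (fun r => A * r + B) := by
    intro A B
    have e1 : ∀ y, d y * (A * (c y / d y) + B) = A * c y + B * d y := fun y => by
      have := (hd0 y).ne'; field_simp
    have e2 : ∀ y, b y * (A * (a y / b y) + B) = A * a y + B * b y := fun y => by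
      have := (hb0 y).ne'; field_simp
    simp only [G, e1, e2, Finset.sum_add_distrib, ← Finset.mul_sum, ha.2, hb.2, hc.2, hd.2]
    exact le_rfl
  have hadd : ∀ g w t, G g → 0 ≤ w → G (fun r => g r + w * max 0 (r - t)) := by
    intro g w t hg hw
    have e1 : ∀ y, d y * (g (c y / d y) + w * max 0 (c y / d y - t)) =
        d y * g (c y / d y) + w * max 0 (c y - t * d y) := fun y => by
      have := (hd0 y).ne'
      have : max 0 (c y - t * d y) = d y * max 0 (c y / d y - t) := by
        rw [mul_max_of_nonneg _ _ (hd0 y).le, mul_zero]; congr 1; field_simp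
      rw [this]; ring
    have e2 : ∀ y, b y * (g (a y / b y) + w * max 0 (a y / b y - t)) =
        b y * g (a y / b y) + w * max 0 (a y - t * b y) := fun y => by
      have := (hb0 y).ne'
      have : max 0 (a y - t * b y) = b y * max 0 (a y / b y - t) := by
        rw [mul_max_of_nonneg _ _ (hb0 y).le, mul_zero]; congr 1; field_simp
      rw [this]; ring
    simp only [G, e1, e2, Finset.sum_add_distrib, ← Finset.mul_sum]
    refine add_le_add hg (mul_le_mul_of_nonneg_left ?_ hw)
    rcases lt_or_ge 0 t with ht | ht
    · exact H t ht
    · have e1 : ∀ y, max 0 (c y - t * d y) = c y - t * d y := fun y =>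
        max_eq_right (by nlinarith [hc.1 y, hd.1 y])
      have e2 : ∀ y, max 0 (a y - t * b y) = a y - t * b y := fun y =>
        max_eq_right (by nlinarith [ha.1 y, hb.1 y])
      simp only [e1, e2, Finset.sum_sub_distrib, ← Finset.mul_sum, ha.2, hb.2, hc.2, hd.2]
      exact le_rfl
  have hR : ∀ r ∈ Finset.univ.image (fun y => c y / d y) ∪ Finset.univ.image (fun x => a x / b x),
      -1 < r := by
    intro r hr
    simp only [Finset.mem_union, Finset.mem_image, Finset.mem_univ, true_and] at hr
    rcases hr with ⟨y, rfl⟩ | ⟨x, rfl⟩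
    · have := div_nonneg (hc.1 y) (hd.1 y); linarith
    · have := div_nonneg (ha.1 x) (hb.1 x); linarith
  obtain ⟨g, hg, hgR⟩ := exists_hinge_interpolation haff hadd hconv
    (fun r => Finset.le_sup' (fun k => α k * r + γ k) hk) hk'.symm _ hR
  have e1 : ∀ y, g (c y / d y) = h (c y / d y) := fun y => hgR _ (by simp)
  have e2 : ∀ x, g (a x / b x) = h (a x / b x) := fun x => hgR _ (by simp)
  simpa only [G, e1, e2] using hg

/-- Blackwell's theorem for finite dichotomies: if every hinge test favours `(a, b)` over `(c, d)`,
then a stochastic matrix maps `(a, b)` to `(c, d)`. -/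
theorem exists_stoch_of_hinge_le {I J : Type} [Fintype I] [Fintype J] {a b : I → ℝ} {c d : J → ℝ}
    (ha : IsProb a) (hb : IsProb b) (hc : IsProb c) (hd : IsProb d)
    (hb0 : ∀ x, 0 < b x) (hd0 : ∀ y, 0 < d y)
    (H : ∀ t > 0, ∑ y, max 0 (c y - t * d y) ≤ ∑ x, max 0 (a x - t * b x)) :
    ∃ T : J → I → ℝ, IsStoch T ∧ (∀ y, ∑ x, T y x * a x = c y) ∧
      (∀ y, ∑ x, T y x * b x = d y) := by
  by_contra hno
  let Φ : (I → J → ℝ) →ₗ[ℝ] (J → ℝ) × (J → ℝ) :=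
    { toFun := fun T => (fun y => ∑ x, T x y * a x, fun y => ∑ x, T x y * b x)
      map_add' := fun S T => by
        ext y <;> simp [add_mul, Finset.sum_add_distrib]
      map_smul' := fun r T => by
        ext y <;> simp [mul_assoc, Finset.mul_sum] }
  let S : Set (I → J → ℝ) := Set.univ.pi fun _ => stdSimplex ℝ J
  have hScomp : IsCompact S := isCompact_univ_pi fun _ => isCompact_stdSimplex ℝ J
  have hSconv : Convex ℝ S := convex_pi fun _ _ => convex_stdSimplex ℝ J
  have hnot : (c, d) ∉ Φ '' S := by
    rintro ⟨T, hT, hTe⟩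
    have hT' : ∀ x, T x ∈ stdSimplex ℝ J := fun x => hT x (Set.mem_univ x)
    exact hno ⟨fun y x => T x y, ⟨fun y x => (hT' x).1 y, fun x => (hT' x).2⟩,
      fun y => congrFun (congrArg Prod.fst hTe) y, fun y => congrFun (congrArg Prod.snd hTe) y⟩
  obtain ⟨f, u, hf, hu⟩ := geometric_hahn_banach_closed_point (hSconv.linear_image Φ)
    (hScomp.image Φ.continuous_of_finiteDimensional).isClosed hnot
  obtain ⟨α, γ, hαγ⟩ : ∃ α γ : J → ℝ, ∀ v w : J → ℝ,
      f (v, w) = ∑ y, (α y * v y + γ y * w y) := by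
    have hsing : ∀ y : J, (fun j => if y = j then (1 : ℝ) else 0) = Pi.single y 1 := fun y => by
      ext j; simp [Pi.single_apply, eq_comm]
    refine ⟨fun y => f (Pi.single y 1, 0), fun y => f (0, Pi.single y 1), fun v w => ?_⟩
    have h1 : f (v, 0) = ∑ y, f (Pi.single y 1, 0) * v y := by
      have := LinearMap.pi_apply_eq_sum_univ (f.toLinearMap ∘ₗ LinearMap.inl ℝ (J → ℝ) (J → ℝ)) v
      simp only [LinearMap.comp_apply, LinearMap.inl_apply, smul_eq_mul] at this
      refine this.trans (Finset.sum_congr rfl fun y _ => ?_)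
      rw [mul_comm, hsing]; rfl
    have h2 : f (0, w) = ∑ y, f (0, Pi.single y 1) * w y := by
      have := LinearMap.pi_apply_eq_sum_univ (f.toLinearMap ∘ₗ LinearMap.inr ℝ (J → ℝ) (J → ℝ)) w
      simp only [LinearMap.comp_apply, LinearMap.inr_apply, smul_eq_mul] at this
      refine this.trans (Finset.sum_congr rfl fun y _ => ?_)
      rw [mul_comm, hsing]; rfl
    rw [Finset.sum_add_distrib, ← h1, ← h2, ← map_add]; simp
  have hne : (Finset.univ : Finset J).Nonempty := by
    by_contra h
    rw [Finset.not_nonempty_iff_eq_empty] at h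
    have := hc.2; rw [h] at this; simp at this
  let φ : ℝ → ℝ := fun r => Finset.univ.sup' hne (fun k => α k * r + γ k)
  have hmain : ∑ y, d y * φ (c y / d y) ≤ ∑ x, b x * φ (a x / b x) :=
    sum_sup_affine_le ha hb hc hd hb0 hd0 H _ hne α γ
  choose k hk using fun x =>
    (Finset.exists_mem_eq_sup' hne (fun k => α k * (a x / b x) + γ k))
  have hmem : (fun x => Pi.single (k x) (1 : ℝ)) ∈ S := fun x _ => single_mem_stdSimplex ℝ (k x)
  have h1 := hf _ (Set.mem_image_of_mem Φ hmem)
  have h2 : f (Φ fun x => Pi.single (k x) (1 : ℝ)) = ∑ x, b x * φ (a x / b x) := by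
    change f (_, _) = _
    rw [hαγ]
    simp only [Finset.mul_sum, ← Finset.sum_add_distrib]
    rw [Finset.sum_comm]
    refine Finset.sum_congr rfl fun x _ => ?_
    rw [show φ (a x / b x) = _ from (hk x).2, Finset.sum_eq_single (k x)]
    · have := (hb0 x).ne'
      simp; field_simp
    · intro y _ hy; simp [hy]
    · simp
  have h3 : f (c, d) ≤ ∑ y, d y * φ (c y / d y) := by
    rw [hαγ]
    refine Finset.sum_le_sum fun y _ => ?_
    have : α y * (c y / d y) + γ y ≤ φ (c y / d y) :=
      Finset.le_sup' (fun k => α k * (c y / d y) + γ k) (Finset.mem_univ y)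
    have h4 := mul_le_mul_of_nonneg_left this (hd.1 y)
    have := (hd0 y).ne'
    calc _ = d y * (α y * (c y / d y) + γ y) := by field_simp
      _ ≤ _ := h4
  linarith

section Words
variable {I : Type}

/-- The log-likelihood ratio of a word. -/
def llr (a b : I → ℝ) (m : ℕ) (f : Fin m → I) : ℝ := ∑ j, Real.log (a (f j) / b (f j))

theorem kpow_nonneg {a : I → ℝ} (ha : ∀ x, 0 ≤ a x) (m : ℕ) (f : Fin m → I) : 0 ≤ kpow a m f :=
  Finset.prod_nonneg fun _ _ => ha _

theorem kpow_pos {a : I → ℝ} (ha : ∀ x, 0 < a x) (m : ℕ) (f : Fin m → I) : 0 < kpow a m f :=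
  Finset.prod_pos fun _ _ => ha _

theorem kpow_eq_zero {a : I → ℝ} {m : ℕ} {f : Fin m → I} {j : Fin m} (h : a (f j) = 0) :
    kpow a m f = 0 := Finset.prod_eq_zero (Finset.mem_univ j) h

theorem kpow_eq_mul_exp {a b : I → ℝ} (ha : ∀ x, 0 ≤ a x) (hb : ∀ x, 0 < b x) {m : ℕ}
    {f : Fin m → I} (h : ∀ j, a (f j) ≠ 0) : kpow a m f = kpow b m f * Real.exp (llr a b m f) := by
  unfold kpow llr
  rw [Real.exp_sum, ← Finset.prod_mul_distrib]
  refine Finset.prod_congr rfl fun j _ => ?_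
  rw [Real.exp_log (div_pos ((ha _).lt_of_ne' (h j)) (hb _))]
  have := (hb (f j)).ne'
  field_simp

theorem prod_zterm {a b : I → ℝ} (β : ℝ) {m : ℕ} {f : Fin m → I} (h : ∀ j, a (f j) ≠ 0) :
    ∏ j, ((if a (f j) = 0 then 0 else b (f j)) * Real.exp (β * Real.log (a (f j) / b (f j)))) =
      kpow b m f * Real.exp (β * llr a b m f) := by
  unfold kpow llr
  rw [Finset.mul_sum, Real.exp_sum, ← Finset.prod_mul_distrib]
  exact Finset.prod_congr rfl fun j _ => by rw [if_neg (h j)]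

theorem prod_zterm_nonneg {a b : I → ℝ} (hb : ∀ x, 0 < b x) (β : ℝ) {m : ℕ} (f : Fin m → I) :
    0 ≤ ∏ j, ((if a (f j) = 0 then 0 else b (f j)) *
      Real.exp (β * Real.log (a (f j) / b (f j)))) := by
  refine Finset.prod_nonneg fun j _ => ?_
  split_ifs
  · simp
  · have := hb (f j); positivity

end Words

section ExponentialFamily
variable {I : Type} [Fintype I]

/-- The partition function `∑ a^β b^(1-β)`, restricted to the support of `a`, in exponential form. -/
def zsum (a b : I → ℝ) (β : ℝ) : ℝ :=
  ∑ x, (if a x = 0 then 0 else b x) * Real.exp (β * Real.log (a x / b x))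

/-- The derivative of `zsum` in the exponent. -/
def zder (a b : I → ℝ) (β : ℝ) : ℝ :=
  ∑ x, (if a x = 0 then 0 else b x) *
    (Real.exp (β * Real.log (a x / b x)) * Real.log (a x / b x))

/-- The logarithmic derivative of `zsum`. -/
def zvel (a b : I → ℝ) (β : ℝ) : ℝ := zder a b β / zsum a b β

/-- The exponentially tilted distribution. -/
def tilt (a b : I → ℝ) (β : ℝ) (x : I) : ℝ :=
  (if a x = 0 then 0 else b x) * Real.exp (β * Real.log (a x / b x)) / zsum a b β

theorem hasDerivAt_zsum (a b : I → ℝ) (β : ℝ) : HasDerivAt (zsum a b) (zder a b β) β := by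
  unfold zsum zder
  refine HasDerivAt.fun_sum fun x _ => ?_
  refine HasDerivAt.const_mul _ ?_
  have := (hasDerivAt_mul_const (x := β) (Real.log (a x / b x))).exp
  simpa using this

theorem continuous_zsum (a b : I → ℝ) : Continuous (zsum a b) := by
  unfold zsum; fun_prop

theorem continuous_zder (a b : I → ℝ) : Continuous (zder a b) := by
  unfold zder; fun_prop

theorem IsProb.exists_ne_zero {a : I → ℝ} (ha : IsProb a) : ∃ x, a x ≠ 0 := by
  by_contra! h
  have := ha.2
  simp [h] at this

theorem zsum_pos {a b : I → ℝ} (ha : IsProb a) (hb : ∀ x, 0 < b x) (β : ℝ) : 0 < zsum a b β := by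
  obtain ⟨x, hx⟩ := ha.exists_ne_zero
  refine Finset.sum_pos' (fun y _ => ?_) ⟨x, Finset.mem_univ _, ?_⟩
  · split_ifs
    · simp
    · have := hb y; positivity
  · rw [if_neg hx]; have := hb x; positivity

theorem continuous_zvel {a b : I → ℝ} (ha : IsProb a) (hb : ∀ x, 0 < b x) :
    Continuous (zvel a b) :=
  (continuous_zder a b).div (continuous_zsum a b) fun β => (zsum_pos ha hb β).ne'

theorem hasDerivAt_log_zsum {a b : I → ℝ} (ha : IsProb a) (hb : ∀ x, 0 < b x) (β : ℝ) :
    HasDerivAt (fun β => Real.log (zsum a b β)) (zvel a b β) β :=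
  (hasDerivAt_zsum a b β).log (zsum_pos ha hb β).ne'

theorem zsum_one {a b : I → ℝ} (ha : IsProb a) (hb : ∀ x, 0 < b x) : zsum a b 1 = 1 := by
  refine Eq.trans (Finset.sum_congr rfl fun x _ => ?_) ha.2
  split_ifs with h
  · simp [h]
  · have h1 := (ha.1 x).lt_of_ne' h
    rw [one_mul, Real.exp_log (div_pos h1 (hb x))]
    have := (hb x).ne'
    field_simp

theorem zsum_zero {a b : I → ℝ} (ha : ∀ x, 0 < a x) (hb : IsProb b) : zsum a b 0 = 1 := by
  rw [← hb.2]
  refine Finset.sum_congr rfl fun x _ => ?_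
  simp [(ha x).ne']

theorem zder_one {a b : I → ℝ} (ha : ∀ x, 0 ≤ a x) (hb : ∀ x, 0 < b x) :
    zder a b 1 = ∑ x, a x * Real.log (a x / b x) := by
  refine Finset.sum_congr rfl fun x _ => ?_
  split_ifs with h
  · simp [h]
  · have h1 := (ha x).lt_of_ne' h
    rw [one_mul, Real.exp_log (div_pos h1 (hb x))]
    have := (hb x).ne'
    field_simp

theorem isProb_tilt {a b : I → ℝ} (ha : IsProb a) (hb : ∀ x, 0 < b x) (β : ℝ) :
    IsProb (tilt a b β) := by
  have hz := zsum_pos ha hb β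
  refine ⟨fun x => div_nonneg ?_ hz.le, ?_⟩
  · split_ifs
    · simp
    · have := hb x; positivity
  · unfold tilt
    rw [← Finset.sum_div]
    exact div_self hz.ne'

theorem sum_tilt_mul_log (a b : I → ℝ) (β : ℝ) :
    ∑ x, tilt a b β x * Real.log (a x / b x) = zvel a b β := by
  unfold tilt zvel zder
  rw [Finset.sum_div]
  refine Finset.sum_congr rfl fun x _ => ?_
  ring

theorem sum_kpow (a : I → ℝ) (m : ℕ) : ∑ f, kpow a m f = (∑ x, a x) ^ m :=
  (Fintype.sum_pow a m).symm

theorem IsProb.kpow {a : I → ℝ} (ha : IsProb a) (m : ℕ) : IsProb (kpow a m) :=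
  ⟨kpow_nonneg ha.1 m, by rw [sum_kpow, ha.2, one_pow]⟩

theorem kpow_tilt {a b : I → ℝ} (β : ℝ) {m : ℕ} {f : Fin m → I} (h : ∀ j, a (f j) ≠ 0) :
    kpow (tilt a b β) m f = kpow b m f * Real.exp (β * llr a b m f) / zsum a b β ^ m := by
  rw [← prod_zterm β h]
  unfold kpow tilt
  rw [Finset.prod_div_distrib]
  simp

theorem zsum_pow (a b : I → ℝ) (β : ℝ) (m : ℕ) :
    zsum a b β ^ m = ∑ f : Fin m → I, ∏ j,
      ((if a (f j) = 0 then 0 else b (f j)) * Real.exp (β * Real.log (a (f j) / b (f j)))) :=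
  Fintype.sum_pow _ m

/-- Chernoff upper bound for the minimum of two product measures. -/
theorem sum_min_le {a b : I → ℝ} (ha : ∀ x, 0 ≤ a x) (hb : ∀ x, 0 < b x) {β : ℝ} (h0 : 0 ≤ β)
    (h1 : β ≤ 1) (m : ℕ) (s : ℝ) :
    ∑ f, min (kpow a m f) (Real.exp s * kpow b m f) ≤ Real.exp ((1 - β) * s) * zsum a b β ^ m := by
  rw [zsum_pow, Finset.mul_sum]
  refine Finset.sum_le_sum fun f _ => ?_
  by_cases h : ∀ j, a (f j) ≠ 0
  · rw [prod_zterm β h, kpow_eq_mul_exp ha hb h, mul_comm (Real.exp s), ← mul_min_of_nonneg _ _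
      (kpow_pos hb m f).le, mul_left_comm, ← Real.exp_add]
    refine mul_le_mul_of_nonneg_left ?_ (kpow_pos hb m f).le
    rcases le_total (llr a b m f) s with hs | hs
    · exact (min_le_left _ _).trans (Real.exp_le_exp.2 (by nlinarith))
    · exact (min_le_right _ _).trans (Real.exp_le_exp.2 (by nlinarith))
  · push Not at h
    obtain ⟨j, hj⟩ := h
    rw [kpow_eq_zero hj]
    exact (min_le_left _ _).trans (mul_nonneg (Real.exp_pos _).le (prod_zterm_nonneg hb β f))

/-- Chernoff upper bound for a hinge test. -/
theorem sum_hinge_le {a b : I → ℝ} (ha : ∀ x, 0 ≤ a x) (hb : ∀ x, 0 < b x) {β : ℝ}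
    (h1 : 1 ≤ β) (m : ℕ) (s : ℝ) :
    ∑ f, max 0 (kpow a m f - Real.exp s * kpow b m f) ≤
      Real.exp ((1 - β) * s) * zsum a b β ^ m := by
  rw [zsum_pow, Finset.mul_sum]
  refine Finset.sum_le_sum fun f _ => ?_
  refine max_le (mul_nonneg (Real.exp_pos _).le (prod_zterm_nonneg hb β f)) ?_
  have hB := kpow_pos hb m f
  by_cases h : ∀ j, a (f j) ≠ 0
  · rw [prod_zterm β h, kpow_eq_mul_exp ha hb h, mul_left_comm, ← Real.exp_add]
    rcases le_total (llr a b m f) s with hs | hs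
    · have := Real.exp_le_exp.2 hs
      have : 0 ≤ kpow b m f * Real.exp ((1 - β) * s + β * llr a b m f) := by positivity
      nlinarith
    · have : Real.exp (llr a b m f) ≤ Real.exp ((1 - β) * s + β * llr a b m f) :=
        Real.exp_le_exp.2 (by nlinarith)
      have h3 : 0 ≤ Real.exp s * kpow b m f := by positivity
      nlinarith
  · push Not at h
    obtain ⟨j, hj⟩ := h
    rw [kpow_eq_zero hj]
    have h3 : 0 ≤ Real.exp s * kpow b m f := by positivity
    have := mul_nonneg (Real.exp_pos ((1 - β) * s)).le (prod_zterm_nonneg (a := a) hb β f)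
    linarith

end ExponentialFamily

theorem eventually_gt_of_hasDerivAt_pos {f : ℝ → ℝ} {f' x : ℝ} (h : HasDerivAt f f' x)
    (hf : 0 < f') : ∀ᶠ y in 𝓝[>] x, f x < f y := by
  have := (hasDerivAt_iff_tendsto_slope.1 h).eventually (lt_mem_nhds hf)
  have := this.filter_mono (nhdsWithin_mono x (fun y (hy : x < y) => hy.ne'))
  filter_upwards [this, self_mem_nhdsWithin] with y hy hxy
  rw [slope_def_field, lt_div_iff₀ (sub_pos.2 hxy)] at hy
  linarith

theorem eventually_lt_of_hasDerivAt_neg {f : ℝ → ℝ} {f' x : ℝ} (h : HasDerivAt f f' x)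
    (hf : f' < 0) : ∀ᶠ y in 𝓝[>] x, f y < f x := by
  filter_upwards [eventually_gt_of_hasDerivAt_pos h.neg (neg_pos.2 hf)] with y hy
  simpa using hy

theorem eventually_left_lt_of_hasDerivAt_pos {f : ℝ → ℝ} {f' x : ℝ} (h : HasDerivAt f f' x)
    (hf : 0 < f') : ∀ᶠ y in 𝓝[<] x, f y < f x := by
  have := (hasDerivAt_iff_tendsto_slope.1 h).eventually (lt_mem_nhds hf)
  have := this.filter_mono (nhdsWithin_mono x (fun y (hy : y < x) => hy.ne))
  filter_upwards [this, self_mem_nhdsWithin] with y hy hxy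
  rw [slope_def_field, lt_div_iff_of_neg (sub_neg.2 hxy)] at hy
  linarith

section Concentration
variable {I : Type} [Fintype I]

theorem exists_upper_tail_bound {w : I → ℝ} (hw : IsProb w) (ℓ : I → ℝ) {η : ℝ} (hη : 0 < η) :
    ∃ θ : ℝ, 0 ≤ θ ∧ θ < 1 ∧ ∀ m : ℕ, ∑ f : Fin m → I,
      (if m * ((∑ x, w x * ℓ x) + η) < ∑ j, ℓ (f j) then kpow w m f else 0) ≤ θ ^ m := by
  set v := ∑ x, w x * ℓ x
  let M : ℝ → ℝ := fun s => ∑ x, w x * Real.exp (s * (ℓ x - (v + η)))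
  have hM : HasDerivAt M (∑ x, w x * (ℓ x - (v + η))) 0 := by
    refine HasDerivAt.fun_sum fun x _ => HasDerivAt.const_mul _ ?_
    have := (hasDerivAt_mul_const (x := (0 : ℝ)) (ℓ x - (v + η))).exp
    simpa using this
  have hM0 : M 0 = 1 := by simp [M, hw.2]
  have hd : ∑ x, w x * (ℓ x - (v + η)) < 0 := by
    simp only [mul_sub, Finset.sum_sub_distrib, ← Finset.sum_mul, hw.2]
    change v - _ < 0
    linarith
  obtain ⟨s, hs, hs0⟩ :=
    ((eventually_lt_of_hasDerivAt_neg hM hd).and self_mem_nhdsWithin).exists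
  have hs0 : 0 < s := hs0
  refine ⟨M s, Finset.sum_nonneg fun x _ => mul_nonneg (hw.1 x) (Real.exp_pos _).le,
    hM0 ▸ hs, fun m => ?_⟩
  have hpow : M s ^ m = ∑ f : Fin m → I, ∏ j, (w (f j) * Real.exp (s * (ℓ (f j) - (v + η)))) :=
    Fintype.sum_pow _ m
  rw [hpow]
  refine Finset.sum_le_sum fun f _ => ?_
  rw [Finset.prod_mul_distrib, ← Real.exp_sum, ← Finset.mul_sum, Finset.sum_sub_distrib]
  simp only [Finset.sum_const, Finset.card_univ, Fintype.card_fin, nsmul_eq_mul]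
  have hk : 0 ≤ ∏ j, w (f j) := kpow_nonneg hw.1 m f
  split_ifs with h
  · refine le_mul_of_one_le_right hk (Real.one_le_exp (mul_nonneg hs0.le ?_))
    linarith
  · positivity

/-- Weak law of large numbers for product measures on a finite alphabet. -/
theorem eventually_half_le_sum_kpow {w : I → ℝ} (hw : IsProb w) (ℓ : I → ℝ) {η : ℝ} (hη : 0 < η) :
    ∀ᶠ m : ℕ in atTop, 1 / 2 ≤ ∑ f : Fin m → I,
      if |∑ j, ℓ (f j) - m * ∑ x, w x * ℓ x| ≤ m * η then kpow w m f else 0 := by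
  obtain ⟨θ₁, h0, h1, hb₁⟩ := exists_upper_tail_bound hw ℓ hη
  obtain ⟨θ₂, h0', h1', hb₂⟩ := exists_upper_tail_bound hw (fun x => -ℓ x) hη
  have t₁ := (tendsto_pow_atTop_nhds_zero_of_lt_one h0 h1).eventually
    (gt_mem_nhds (show (0 : ℝ) < 1 / 4 by norm_num))
  have t₂ := (tendsto_pow_atTop_nhds_zero_of_lt_one h0' h1').eventually
    (gt_mem_nhds (show (0 : ℝ) < 1 / 4 by norm_num))
  filter_upwards [t₁, t₂] with m hm₁ hm₂
  have e := (hw.kpow m).2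
  have key : ∑ f, kpow w m f ≤ ∑ f : Fin m → I,
      ((if |∑ j, ℓ (f j) - m * ∑ x, w x * ℓ x| ≤ m * η then kpow w m f else 0) +
      (if m * ((∑ x, w x * ℓ x) + η) < ∑ j, ℓ (f j) then kpow w m f else 0) +
      (if m * ((∑ x, w x * -ℓ x) + η) < ∑ j, -ℓ (f j) then kpow w m f else 0)) := by
    refine Finset.sum_le_sum fun f _ => ?_
    have hk := kpow_nonneg hw.1 m f
    simp only [mul_neg, Finset.sum_neg_distrib]
    by_cases c1 : |∑ j, ℓ (f j) - m * ∑ x, w x * ℓ x| ≤ m * η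
    · rw [if_pos c1]; split_ifs <;> linarith
    · rw [if_neg c1]
      rcases lt_abs.1 (not_le.1 c1) with c | c
      · rw [if_pos (by linarith)]; split_ifs <;> linarith
      · rw [if_pos (show (m : ℝ) * (-∑ x, w x * ℓ x + η) < -∑ j, ℓ (f j) by linarith)]
        split_ifs <;> linarith
  rw [Finset.sum_add_distrib, Finset.sum_add_distrib, e] at key
  have := hb₁ m
  have := hb₂ m
  linarith

end Concentration

/-- `P m τ` holds for all large `m`, uniformly for `τ` near `τ₀`. -/
def LocallyEventually (P : ℕ → ℝ → Prop) (τ₀ : ℝ) : Prop :=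
  ∃ η > 0, ∀ᶠ m in atTop, ∀ τ, |τ - τ₀| ≤ η → P m τ

theorem LocallyEventually.eventually_forall_Icc {P : ℕ → ℝ → Prop} {u v : ℝ}
    (h : ∀ τ ∈ Set.Icc u v, LocallyEventually P τ) :
    ∀ᶠ m in atTop, ∀ τ ∈ Set.Icc u v, P m τ := by
  refine isCompact_Icc.induction_on (p := fun s => ∀ᶠ m in atTop, ∀ τ ∈ s, P m τ) ?_ ?_ ?_ ?_
  · simp
  · exact fun s t hst ht => ht.mono fun m hm τ hτ => hm τ (hst hτ)
  · exact fun s t hs ht => (hs.and ht).mono fun m hm τ hτ => hτ.elim (hm.1 τ) (hm.2 τ)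
  · intro τ hτ
    obtain ⟨η, hη, hP⟩ := h τ hτ
    refine ⟨Metric.closedBall τ η, mem_nhdsWithin_of_mem_nhds (Metric.closedBall_mem_nhds τ hη), ?_⟩
    exact hP.mono fun m hm σ hσ => hm σ (by simpa [Real.dist_eq] using hσ)

theorem eventually_exp_neg_mul_le {δ : ℝ} (hδ : 0 < δ) {κ : ℝ} (hκ : 0 < κ) :
    ∀ᶠ m : ℕ in atTop, Real.exp (-(m * δ)) ≤ κ := by
  have h : Tendsto (fun m : ℕ => Real.exp (-(m * δ))) atTop (𝓝 0) :=
    Real.tendsto_exp_neg_atTop_nhds_zero.comp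
      (tendsto_natCast_atTop_atTop.atTop_mul_const hδ)
  exact (h.eventually (gt_mem_nhds hκ)).mono fun m hm => hm.le

section LowerBounds
variable {I : Type} [Fintype I]

/-- Cramér-type lower bound for the minimum of two product measures. -/
theorem eventually_le_sum_min {c d : I → ℝ} (hc : IsProb c) (hc0 : ∀ x, 0 < c x)
    (hd0 : ∀ x, 0 < d x) {β : ℝ} (h0 : 0 ≤ β) (h1 : β ≤ 1) {η : ℝ} (hη : 0 < η) :
    ∀ᶠ m : ℕ in atTop, ∀ τ, |τ - zvel c d β| ≤ η →
      1 / 2 * (Real.exp (m * ((1 - β) * zvel c d β - 2 * η)) * zsum c d β ^ m) ≤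
        ∑ f, min (kpow c m f) (Real.exp (m * τ) * kpow d m f) := by
  filter_upwards [eventually_half_le_sum_kpow (isProb_tilt hc hd0 β)
    (fun x => Real.log (c x / d x)) hη] with m hm τ hτ
  rw [sum_tilt_mul_log] at hm
  have hz : 0 < zsum c d β ^ m := pow_pos (zsum_pos hc hd0 β) m
  refine (mul_le_mul_of_nonneg_right hm (by positivity)).trans ?_
  rw [Finset.sum_mul]
  refine Finset.sum_le_sum fun f _ => ?_
  have hD := kpow_pos hd0 m f
  have hne : ∀ j, c (f j) ≠ 0 := fun j => (hc0 _).ne'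
  have hmη : 0 ≤ m * η := by positivity
  split_ifs with h
  · change |llr c d m f - _| ≤ _ at h
    rw [kpow_tilt β hne, kpow_eq_mul_exp hc.1 hd0 hne, mul_comm (Real.exp (m * τ))]
    set L := llr c d m f
    set v := zvel c d β
    have hL := abs_le.1 h
    have hτ' := abs_le.1 hτ
    have hm0 : (0 : ℝ) ≤ m := Nat.cast_nonneg m
    have e : kpow d m f * Real.exp (β * L) / zsum c d β ^ m *
        (Real.exp (m * ((1 - β) * v - 2 * η)) * zsum c d β ^ m) =
        kpow d m f * Real.exp (β * L + m * ((1 - β) * v - 2 * η)) := by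
      rw [Real.exp_add]; field_simp
    rw [e]
    refine le_min ?_ ?_
    · refine mul_le_mul_of_nonneg_left (Real.exp_le_exp.2 ?_) hD.le
      nlinarith [mul_le_mul_of_nonneg_left (show m * v - L ≤ m * η by linarith)
        (sub_nonneg.2 h1), mul_nonneg h0 hmη]
    · refine mul_le_mul_of_nonneg_left (Real.exp_le_exp.2 ?_) hD.le
      nlinarith [mul_le_mul_of_nonneg_left hL.2 h0, mul_le_mul_of_nonneg_left hτ'.1 hm0,
        mul_nonneg (sub_nonneg.2 h1) hmη]
  · rw [zero_mul]
    exact le_min (kpow_nonneg hc.1 m f) (by positivity)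

/-- Cramér-type lower bound for a hinge test. -/
theorem eventually_le_sum_hinge {a b : I → ℝ} (ha : IsProb a)
    (hb0 : ∀ x, 0 < b x) {β : ℝ} (h1 : 1 ≤ β) {η : ℝ} (hη : 0 < η) :
    ∀ᶠ m : ℕ in atTop, ∀ τ, τ ≤ zvel a b β - 2 * η →
      1 / 4 * (Real.exp (m * ((1 - β) * (zvel a b β + η))) * zsum a b β ^ m) ≤
        ∑ f, max 0 (kpow a m f - Real.exp (m * τ) * kpow b m f) := by
  filter_upwards [eventually_half_le_sum_kpow (isProb_tilt ha hb0 β)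
    (fun x => Real.log (a x / b x)) hη,
    eventually_exp_neg_mul_le hη (show (0 : ℝ) < 1 / 2 by norm_num)] with m hm hm2 τ hτ
  rw [sum_tilt_mul_log] at hm
  have hz : 0 < zsum a b β ^ m := pow_pos (zsum_pos ha hb0 β) m
  have hpos : 0 ≤ 1 / 2 * (Real.exp (m * ((1 - β) * (zvel a b β + η))) * zsum a b β ^ m) := by
    positivity
  have := mul_le_mul_of_nonneg_right hm hpos
  refine le_trans (by linarith) (this.trans ?_)
  rw [Finset.sum_mul]
  refine Finset.sum_le_sum fun f _ => ?_
  have hB := kpow_pos hb0 m f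
  by_cases hne : ∀ j, a (f j) ≠ 0
  · split_ifs with h
    · change |llr a b m f - _| ≤ _ at h
      refine le_trans ?_ (le_max_right _ _)
      rw [kpow_tilt β hne, kpow_eq_mul_exp ha.1 hb0 hne]
      set L := llr a b m f
      set v := zvel a b β
      have hL := abs_le.1 h
      have hm0 : (0 : ℝ) ≤ m := Nat.cast_nonneg m
      have e : kpow b m f * Real.exp (β * L) / zsum a b β ^ m *
          (1 / 2 * (Real.exp (m * ((1 - β) * (v + η))) * zsum a b β ^ m)) =
          1 / 2 * (kpow b m f * Real.exp (β * L + m * ((1 - β) * (v + η)))) := by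
        rw [Real.exp_add]; field_simp
      rw [e]
      have h2 : Real.exp (β * L + m * ((1 - β) * (v + η))) ≤ Real.exp L :=
        Real.exp_le_exp.2 (by nlinarith)
      have h3 : Real.exp (m * τ) ≤ Real.exp L * Real.exp (-(m * η)) := by
        rw [← Real.exp_add]
        refine Real.exp_le_exp.2 ?_
        nlinarith [mul_le_mul_of_nonneg_left hτ hm0]
      have h4 : Real.exp L * Real.exp (-(m * η)) ≤ Real.exp L * (1 / 2) :=
        mul_le_mul_of_nonneg_left hm2 (Real.exp_pos L).le
      nlinarith [mul_le_mul_of_nonneg_left h2 hB.le, mul_le_mul_of_nonneg_left (h3.trans h4) hB.le]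
    · rw [zero_mul]; exact le_max_left _ _
  · push Not at hne
    obtain ⟨j, hj⟩ := hne
    have : kpow (tilt a b β) m f = 0 := kpow_eq_zero (j := j) (by simp [tilt, hj])
    simp [this]

end LowerBounds

section Comparison
variable {I J : Type} [Fintype I] [Fintype J]

theorem locallyEventually_sum_min_le {a b : I → ℝ} {c d : J → ℝ} (ha : IsProb a)
    (hb0 : ∀ x, 0 < b x) (hc : IsProb c) (hc0 : ∀ y, 0 < c y) (hd0 : ∀ y, 0 < d y)
    {β β₁ τ₀ : ℝ} (h0 : 0 ≤ β) (h1 : β ≤ 1) (h0' : 0 ≤ β₁) (h1' : β₁ ≤ 1)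
    (hv : zvel c d β₁ = τ₀)
    (hlt : (1 - β) * τ₀ + Real.log (zsum a b β) < (1 - β₁) * τ₀ + Real.log (zsum c d β₁)) :
    LocallyEventually (fun m τ => ∑ f, min (kpow a m f) (Real.exp (m * τ) * kpow b m f) ≤
      ∑ f, min (kpow c m f) (Real.exp (m * τ) * kpow d m f)) τ₀ := by
  set δ := (1 - β₁) * τ₀ + Real.log (zsum c d β₁) - ((1 - β) * τ₀ + Real.log (zsum a b β)) with hδ
  have hδ0 : 0 < δ := by linarith
  have hη : 0 < δ / 4 := by linarith
  refine ⟨δ / 4, hη, ?_⟩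
  filter_upwards [eventually_le_sum_min hc hc0 hd0 h0' h1' hη,
    eventually_exp_neg_mul_le hη (show (0 : ℝ) < 1 / 2 by norm_num)] with m hm hm2 τ hτ
  refine (sum_min_le ha.1 hb0 h0 h1 m _).trans (le_trans ?_ (hm τ (by rwa [hv])))
  have hza := zsum_pos ha hb0 β
  have hzc := zsum_pos hc hd0 β₁
  have e1 : zsum a b β ^ m = Real.exp (m * Real.log (zsum a b β)) := by
    rw [Real.exp_nat_mul, Real.exp_log hza]
  have e2 : zsum c d β₁ ^ m = Real.exp (m * Real.log (zsum c d β₁)) := by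
    rw [Real.exp_nat_mul, Real.exp_log hzc]
  rw [e1, e2, ← Real.exp_add, ← Real.exp_add, hv]
  refine le_trans (Real.exp_le_exp.2 ?_) ((Real.exp_add _ _).le.trans
    (mul_le_mul_of_nonneg_right hm2 (Real.exp_pos _).le))
  have hm0 : (0 : ℝ) ≤ m := Nat.cast_nonneg m
  have hτ' := abs_le.1 hτ
  have : (1 - β) * (τ - τ₀) ≤ δ / 4 := by nlinarith
  nlinarith [mul_le_mul_of_nonneg_left this hm0]

theorem locallyEventually_sum_hinge_le {a b : I → ℝ} {c d : J → ℝ} (ha : IsProb a)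
    (hb0 : ∀ x, 0 < b x) (hc : IsProb c) (hd0 : ∀ y, 0 < d y)
    {β β₁ τ₀ : ℝ} (h1 : 1 ≤ β) (h1' : 1 ≤ β₁) (hv : τ₀ < zvel a b β₁)
    (hlt : (1 - β) * τ₀ + Real.log (zsum c d β) <
      (1 - β₁) * zvel a b β₁ + Real.log (zsum a b β₁)) :
    LocallyEventually (fun m τ => ∑ f, max 0 (kpow c m f - Real.exp (m * τ) * kpow d m f) ≤
      ∑ f, max 0 (kpow a m f - Real.exp (m * τ) * kpow b m f)) τ₀ := by
  set v := zvel a b β₁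
  set δ := (1 - β₁) * v + Real.log (zsum a b β₁) - ((1 - β) * τ₀ + Real.log (zsum c d β)) with hδ
  have hδ0 : 0 < δ := by linarith
  obtain ⟨η, hη, hη1, hη2⟩ : ∃ η > 0, 3 * η ≤ v - τ₀ ∧ (β + β₁) * η ≤ δ / 2 := by
    refine ⟨min ((v - τ₀) / 3) (δ / 2 / (β + β₁)), lt_min (by linarith) (by positivity), ?_, ?_⟩
    · have := min_le_left ((v - τ₀) / 3) (δ / 2 / (β + β₁)); linarith
    · have := min_le_right ((v - τ₀) / 3) (δ / 2 / (β + β₁))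
      rw [mul_comm]; exact (le_div_iff₀ (by linarith)).1 this
  refine ⟨η, hη, ?_⟩
  filter_upwards [eventually_le_sum_hinge ha hb0 h1' hη,
    eventually_exp_neg_mul_le (half_pos hδ0) (show (0 : ℝ) < 1 / 4 by norm_num)] with m hm hm2 τ hτ
  have hτ' := abs_le.1 hτ
  refine (sum_hinge_le hc.1 hd0 h1 m _).trans (le_trans ?_ (hm τ (by change τ ≤ v - _; linarith)))
  have hza := zsum_pos ha hb0 β₁
  have hzc := zsum_pos hc hd0 β
  have e1 : zsum a b β₁ ^ m = Real.exp (m * Real.log (zsum a b β₁)) := by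
    rw [Real.exp_nat_mul, Real.exp_log hza]
  have e2 : zsum c d β ^ m = Real.exp (m * Real.log (zsum c d β)) := by
    rw [Real.exp_nat_mul, Real.exp_log hzc]
  rw [e1, e2, ← Real.exp_add, ← Real.exp_add]
  refine le_trans (Real.exp_le_exp.2 ?_) ((Real.exp_add _ _).le.trans
    (mul_le_mul_of_nonneg_right hm2 (Real.exp_pos _).le))
  have hm0 : (0 : ℝ) ≤ m := Nat.cast_nonneg m
  have : (β - 1) * (τ₀ - τ) ≤ (β - 1) * η := mul_le_mul_of_nonneg_left (by linarith) (by linarith)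
  have h5 : (1 - β) * τ + Real.log (zsum c d β) + δ / 2 ≤
      (1 - β₁) * (v + η) + Real.log (zsum a b β₁) := by nlinarith
  nlinarith [mul_le_mul_of_nonneg_left h5 hm0]

end Comparison

theorem kpow_le_exp_mul {I : Type} {c d : I → ℝ} (hc : ∀ x, 0 ≤ c x) {κ : ℝ}
    (h : ∀ x, c x ≤ Real.exp κ * d x) (m : ℕ) (f : Fin m → I) :
    kpow c m f ≤ Real.exp (m * κ) * kpow d m f := by
  rw [Real.exp_nat_mul]
  refine (Finset.prod_le_prod (fun j _ => hc _) fun j _ => h (f j)).trans ?_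
  rw [Finset.prod_mul_distrib]
  simp [kpow]

section Swap
variable {I : Type} [Fintype I]

theorem sum_hinge_eq_one_sub_sum_min {A B : I → ℝ} (hA : IsProb A) (t : ℝ) :
    ∑ x, max 0 (A x - t * B x) = 1 - ∑ x, min (A x) (t * B x) := by
  rw [← hA.2, ← Finset.sum_sub_distrib]
  refine Finset.sum_congr rfl fun x _ => ?_
  rcases le_total (A x) (t * B x) with h | h
  · rw [min_eq_left h, max_eq_left (by linarith)]; ring
  · rw [min_eq_right h, max_eq_right (by linarith)]

theorem sum_hinge_swap {A B : I → ℝ} (hA : IsProb A) (hB : IsProb B) {t : ℝ} (ht : 0 < t) :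
    ∑ x, max 0 (A x - t * B x) = 1 - t + t * ∑ x, max 0 (B x - t⁻¹ * A x) := by
  have : 1 - t = ∑ x, (A x - t * B x) := by
    rw [Finset.sum_sub_distrib, ← Finset.mul_sum, hA.2, hB.2, mul_one]
  rw [this, Finset.mul_sum, ← Finset.sum_add_distrib]
  refine Finset.sum_congr rfl fun x _ => ?_
  rw [mul_max_of_nonneg _ _ ht.le, mul_zero, mul_sub, mul_inv_cancel_left₀ ht.ne']
  rcases le_total (A x) (t * B x) with h | h
  · rw [max_eq_left (by linarith), max_eq_right (by linarith)]; ring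
  · rw [max_eq_right (by linarith), max_eq_left (by linarith)]; ring

theorem zder_zero_eq_neg {c d : I → ℝ} (hc0 : ∀ x, 0 < c x) (hd0 : ∀ x, 0 < d x) :
    zder c d 0 = -zder d c 1 := by
  rw [zder_one (fun x => (hd0 x).le) hc0, ← Finset.sum_neg_distrib]
  refine Finset.sum_congr rfl fun x _ => ?_
  rw [if_neg (hc0 x).ne', ← inv_div, Real.log_inv]
  simp

theorem zvel_one {c d : I → ℝ} (hc : IsProb c) (hd0 : ∀ x, 0 < d x) :
    zvel c d 1 = zder c d 1 := by rw [zvel, zsum_one hc hd0, div_one]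

theorem zvel_zero {c d : I → ℝ} (hc0 : ∀ x, 0 < c x) (hd : IsProb d) :
    zvel c d 0 = zder c d 0 := by rw [zvel, zsum_zero hc0 hd, div_one]

theorem zsum_zero_lt_one {a b : I → ℝ} (hb : IsProb b) (hb0 : ∀ x, 0 < b x)
    (ha : ∃ x, a x = 0) : zsum a b 0 < 1 := by
  obtain ⟨x, hx⟩ := ha
  rw [← hb.2]
  refine Finset.sum_lt_sum (fun y _ => ?_) ⟨x, Finset.mem_univ x, ?_⟩
  · split_ifs
    · simpa using hb.1 y
    · simp
  · simpa [hx] using hb0 x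

theorem exists_forall_lt_zvel {a b : I → ℝ} (ha : IsProb a) (hb0 : ∀ x, 0 < b x) {τ : ℝ}
    (h : ∃ x, Real.exp τ * b x < a x) : ∃ B, ∀ β, B ≤ β → τ < zvel a b β := by
  obtain ⟨x, hx⟩ := h
  let w : I → ℝ := fun y => if a y = 0 then 0 else b y
  let u : I → ℝ := fun y => Real.log (a y / b y) - τ
  have hw : ∀ y, 0 ≤ w y := fun y => by
    simp only [w]; split_ifs; exacts [le_rfl, (hb0 y).le]
  have hax : 0 < a x := lt_trans (mul_pos (Real.exp_pos _) (hb0 x)) hx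
  have hwx : 0 < w x := by simp only [w, if_neg hax.ne', hb0 x]
  have hux : 0 < u x := by
    refine sub_pos.2 ((Real.lt_log_iff_exp_lt (div_pos hax (hb0 x))).2 ?_)
    rwa [lt_div_iff₀ (hb0 x)]
  set S := ∑ y, w y * |u y|
  have hS : 0 ≤ S := Finset.sum_nonneg fun y _ => mul_nonneg (hw y) (abs_nonneg _)
  refine ⟨S / (w x * u x * u x), fun β hβ => ?_⟩
  have hβ0 : 0 ≤ β := le_trans (by positivity) hβ
  rw [div_le_iff₀ (by positivity)] at hβ
  rw [zvel, lt_div_iff₀ (zsum_pos ha hb0 β), ← sub_pos]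
  have e : zder a b β - τ * zsum a b β =
      Real.exp (β * τ) * ∑ y, w y * (u y * Real.exp (β * u y)) := by
    unfold zder zsum
    rw [Finset.mul_sum, Finset.mul_sum, ← Finset.sum_sub_distrib]
    refine Finset.sum_congr rfl fun y _ => ?_
    have : Real.exp (β * Real.log (a y / b y)) = Real.exp (β * τ) * Real.exp (β * u y) := by
      rw [← Real.exp_add]; congr 1; simp only [u]; ring
    rw [this]; simp only [u, w]; ring
  rw [e]
  refine mul_pos (Real.exp_pos _) ?_
  have hterm : ∀ y ∈ Finset.univ, 0 ≤ w y * (u y * Real.exp (β * u y)) + w y * |u y| := by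
    intro y _
    rw [← mul_add]
    refine mul_nonneg (hw y) ?_
    rcases le_total 0 (u y) with hu | hu
    · have := abs_nonneg (u y); positivity
    · rw [abs_of_nonpos hu]
      have : Real.exp (β * u y) ≤ 1 := Real.exp_le_one_iff.2 (mul_nonpos_of_nonneg_of_nonpos hβ0 hu)
      nlinarith
  have h1 := Finset.single_le_sum hterm (Finset.mem_univ x)
  rw [Finset.sum_add_distrib] at h1
  have h2 : β * u x + 1 ≤ Real.exp (β * u x) := Real.add_one_le_exp _
  have h3 : w x * (u x * (β * u x + 1)) ≤ w x * (u x * Real.exp (β * u x)) := by gcongr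
  have h4 : 0 ≤ w x * |u x| := mul_nonneg hwx.le (abs_nonneg _)
  have h5 : 0 < w x * u x := mul_pos hwx hux
  change _ ≤ _ + S at h1
  nlinarith

end Swap

section Regimes
variable {I J : Type} [Fintype I] [Fintype J]

/-- Strict domination of `(c, d)` by `(a, b)` for all Rényi orders in `[1, ∞]`. -/
structure StrictDom (a b : I → ℝ) (c d : J → ℝ) : Prop where
  zsum_lt : ∀ β, 1 < β → zsum c d β < zsum a b β
  zder_lt : zder c d 1 < zder a b 1
  max_lt : ∃ κ, (∀ y, c y ≤ Real.exp κ * d y) ∧ ∃ x, Real.exp κ * b x < a x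

/-- The hinge-test comparison between the `m`-th powers at threshold `exp (m * τ)`. -/
def HingeLE (a b : I → ℝ) (c d : J → ℝ) (m : ℕ) (τ : ℝ) : Prop :=
  ∑ f, max 0 (kpow c m f - Real.exp (m * τ) * kpow d m f) ≤
    ∑ f, max 0 (kpow a m f - Real.exp (m * τ) * kpow b m f)

theorem hingeLE_of_swap {a b : I → ℝ} {c d : J → ℝ} (ha : IsProb a) (hb : IsProb b)
    (hc : IsProb c) (hd : IsProb d) {m : ℕ} {τ : ℝ} (h : HingeLE b a d c m (-τ)) :
    HingeLE a b c d m τ := by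
  unfold HingeLE at *
  rw [mul_neg, Real.exp_neg] at h
  rw [sum_hinge_swap (hc.kpow m) (hd.kpow m) (Real.exp_pos _),
    sum_hinge_swap (ha.kpow m) (hb.kpow m) (Real.exp_pos _)]
  gcongr

theorem locallyEventually_hingeLE_of_swap {a b : I → ℝ} {c d : J → ℝ} (ha : IsProb a)
    (hb : IsProb b) (hc : IsProb c) (hd : IsProb d) {τ₀ : ℝ}
    (h : LocallyEventually (HingeLE b a d c) (-τ₀)) : LocallyEventually (HingeLE a b c d) τ₀ := by
  obtain ⟨η, hη, h⟩ := h
  refine ⟨η, hη, h.mono fun m hm τ hτ => hingeLE_of_swap ha hb hc hd (hm (-τ) ?_)⟩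
  rwa [← abs_neg, neg_sub_neg, neg_sub]

theorem exists_zsum_exponent_neg {c d : J → ℝ} (hc : IsProb c) (hd0 : ∀ y, 0 < d y) {τ : ℝ}
    (h : zvel c d 1 < τ) : ∃ β, 1 < β ∧ (1 - β) * τ + Real.log (zsum c d β) < 0 := by
  have h1 : HasDerivAt (fun β => (1 - β) * τ + Real.log (zsum c d β)) (-1 * τ + zvel c d 1) 1 :=
    (((hasDerivAt_id (1 : ℝ)).const_sub 1).mul_const τ).add (hasDerivAt_log_zsum hc hd0 1)
  obtain ⟨β, hβ, hβ1⟩ :=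
    ((eventually_lt_of_hasDerivAt_neg h1 (by linarith)).and self_mem_nhdsWithin).exists
  refine ⟨β, hβ1, hβ.trans_eq ?_⟩
  simp [zsum_one hc hd0]

/-- Local comparison above the relative entropy of the target. -/
theorem StrictDom.locallyEventually_hingeLE {a b : I → ℝ} {c d : J → ℝ} (h : StrictDom a b c d)
    (ha : IsProb a) (hb0 : ∀ x, 0 < b x) (hc : IsProb c) (hd0 : ∀ y, 0 < d y) {τ₀ : ℝ}
    (hτ : zvel c d 1 < τ₀) (hmax : ∃ x, Real.exp τ₀ * b x < a x) :
    LocallyEventually (HingeLE a b c d) τ₀ := by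
  suffices H : ∃ β₁, 1 ≤ β₁ ∧ τ₀ < zvel a b β₁ ∧ ∃ β, 1 ≤ β ∧
      (1 - β) * τ₀ + Real.log (zsum c d β) <
        (1 - β₁) * zvel a b β₁ + Real.log (zsum a b β₁) by
    obtain ⟨β₁, h1, h2, β, h3, h4⟩ := H
    exact locallyEventually_sum_hinge_le ha hb0 hc hd0 h3 h1 h2 h4
  obtain ⟨β₀, hβ₀, hneg⟩ := exists_zsum_exponent_neg hc hd0 hτ
  by_cases hcase : τ₀ < zvel a b 1
  · refine ⟨1, le_rfl, hcase, β₀, hβ₀.le, ?_⟩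
    simpa [zsum_one ha hb0] using hneg
  push Not at hcase
  obtain ⟨B, hB⟩ := exists_forall_lt_zvel ha hb0 hmax
  have hcont := continuous_zvel ha hb0
  have hcomp : IsCompact (Set.Icc 1 (max B 1) ∩ {β | zvel a b β ≤ τ₀}) :=
    isCompact_Icc.inter_right (isClosed_le hcont continuous_const)
  obtain ⟨β', ⟨⟨h1, -⟩, hle⟩, hub⟩ :=
    hcomp.exists_isGreatest ⟨1, ⟨le_rfl, le_max_right _ _⟩, hcase⟩
  have hgt : ∀ β, β' < β → τ₀ < zvel a b β := by
    intro β hβ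
    by_contra hcon
    push Not at hcon
    rcases le_total β (max B 1) with hm | hm
    · exact (hub ⟨⟨h1.trans hβ.le, hm⟩, hcon⟩).not_gt hβ
    · exact (hB β ((le_max_left _ _).trans hm)).not_ge hcon
  have heq : zvel a b β' = τ₀ := by
    refine le_antisymm hle (ge_of_tendsto (hcont.continuousAt.continuousWithinAt (s := Set.Ioi β'))
      ?_)
    filter_upwards [self_mem_nhdsWithin] with β hβ using (hgt β hβ).le
  obtain ⟨β, hβ1, hβ⟩ : ∃ β, 1 ≤ β ∧ (1 - β) * τ₀ + Real.log (zsum c d β) <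
      (1 - β') * zvel a b β' + Real.log (zsum a b β') := by
    rcases h1.eq_or_lt with h1 | h1
    · refine ⟨β₀, hβ₀.le, ?_⟩
      rw [← h1]
      simpa [zsum_one ha hb0] using hneg
    · refine ⟨β', h1.le, ?_⟩
      rw [heq]
      have := Real.log_lt_log (zsum_pos hc hd0 β') (h.zsum_lt β' h1)
      linarith
  have hcont2 : Continuous fun β => (1 - β) * zvel a b β + Real.log (zsum a b β) :=
    ((continuous_const.sub continuous_id).mul hcont).add
      ((continuous_zsum a b).log fun β => (zsum_pos ha hb0 β).ne')
  have hev := (hcont2.continuousAt.continuousWithinAt (s := Set.Ioi β')).eventually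
    (lt_mem_nhds hβ)
  obtain ⟨β₁, hβ₁, hgt₁⟩ := (hev.and self_mem_nhdsWithin).exists
  exact ⟨β₁, h1.trans (le_of_lt hgt₁), hgt β₁ hgt₁, β, hβ1, hβ₁⟩

/-- Local comparison in the swapped roles when `a` does not have full support. -/
theorem locallyEventually_hingeLE_of_eq_zero {a b : I → ℝ} {c d : J → ℝ}
    (hb : IsProb b) (hb0 : ∀ x, 0 < b x) (hd : IsProb d) (hc0 : ∀ y, 0 < c y) {τ₀ : ℝ}
    (hτ : zvel d c 1 < τ₀) (h0 : ∃ x, a x = 0) : LocallyEventually (HingeLE b a d c) τ₀ := by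
  obtain ⟨β, hβ, hneg⟩ := exists_zsum_exponent_neg hd hc0 hτ
  set δ := -((1 - β) * τ₀ + Real.log (zsum d c β)) with hδ
  have hδ0 : 0 < δ := by linarith
  have hz := zsum_zero_lt_one hb hb0 h0
  have hz0 : 0 ≤ zsum a b 0 := Finset.sum_nonneg fun x _ => by
    split_ifs
    · simp
    · have := hb0 x; positivity
  refine ⟨δ / 2 / (β - 1), by have := sub_pos.2 hβ; positivity, ?_⟩
  filter_upwards [eventually_exp_neg_mul_le (half_pos hδ0) (show (0 : ℝ) < 1 / 2 by norm_num),
    (tendsto_pow_atTop_nhds_zero_of_lt_one hz0 hz).eventually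
      (gt_mem_nhds (show (0 : ℝ) < 1 / 2 by norm_num))] with m hm hm2 τ hτ'
  have hlow : 1 - zsum a b 0 ^ m ≤ ∑ f, max 0 (kpow b m f - Real.exp (m * τ) * kpow a m f) := by
    rw [← (hb.kpow m).2, zsum_pow, ← Finset.sum_sub_distrib]
    refine Finset.sum_le_sum fun f _ => ?_
    by_cases h : ∀ j, a (f j) ≠ 0
    · rw [prod_zterm 0 h]; simp
    · push Not at h
      obtain ⟨j, hj⟩ := h
      refine le_trans ?_ (le_max_right _ _)
      rw [kpow_eq_zero (a := a) hj]
      have := prod_zterm_nonneg (a := a) hb0 0 f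
      linarith
  refine (sum_hinge_le hd.1 hc0 hβ.le m _).trans (le_trans (le_trans ?_ hm) (le_trans ?_ hlow))
  · have e1 : zsum d c β ^ m = Real.exp (m * Real.log (zsum d c β)) := by
      rw [Real.exp_nat_mul, Real.exp_log (zsum_pos hd hc0 β)]
    rw [e1, ← Real.exp_add]
    refine Real.exp_le_exp.2 ?_
    have hm0 : (0 : ℝ) ≤ m := Nat.cast_nonneg m
    have h3 := (le_div_iff₀ (sub_pos.2 hβ)).1 hτ'
    have h4 : (1 - β) * (τ - τ₀) ≤ δ / 2 := by
      nlinarith [neg_abs_le (τ - τ₀), sub_pos.2 hβ]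
    have h5 : (1 - β) * τ + Real.log (zsum d c β) ≤ -(δ / 2) := by nlinarith
    nlinarith [mul_le_mul_of_nonneg_left h5 hm0]
  · linarith

/-- Local comparison between the two relative entropies of the target. -/
theorem locallyEventually_hingeLE_middle {a b : I → ℝ} {c d : J → ℝ}
    (ha : IsProb a) (hb : IsProb b) (hb0 : ∀ x, 0 < b x)
    (hc : IsProb c) (hc0 : ∀ y, 0 < c y) (hd : IsProb d) (hd0 : ∀ y, 0 < d y)
    (hA : ∀ β, 0 < β → β < 1 → zsum a b β < zsum c d β) (hB : StrictDom a b c d)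
    (hC : (∀ x, 0 < a x) → StrictDom b a d c) {τ₀ : ℝ} (h0 : zvel c d 0 ≤ τ₀)
    (h1 : τ₀ ≤ zvel c d 1) : LocallyEventually (HingeLE a b c d) τ₀ := by
  obtain ⟨β₁, ⟨hβ0, hβ1⟩, hv⟩ := intermediate_value_Icc zero_le_one
    (continuous_zvel hc hd0).continuousOn (show τ₀ ∈ Set.Icc _ _ from ⟨h0, h1⟩)
  suffices H : ∃ β, 0 ≤ β ∧ β ≤ 1 ∧ (1 - β) * τ₀ + Real.log (zsum a b β) <
      (1 - β₁) * τ₀ + Real.log (zsum c d β₁) by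
    obtain ⟨β, hb1, hb2, hlt⟩ := H
    obtain ⟨η, hη, h⟩ := locallyEventually_sum_min_le ha hb0 hc hc0 hd0 hb1 hb2 hβ0 hβ1 hv hlt
    refine ⟨η, hη, h.mono fun m hm τ hτ => ?_⟩
    have := hm τ hτ
    unfold HingeLE
    rw [sum_hinge_eq_one_sub_sum_min (hc.kpow m), sum_hinge_eq_one_sub_sum_min (ha.kpow m)]
    linarith
  have hder : ∀ β₀, HasDerivAt (fun β => (1 - β) * τ₀ + Real.log (zsum a b β))
      (-1 * τ₀ + zvel a b β₀) β₀ := fun β₀ =>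
    (((hasDerivAt_id β₀).const_sub 1).mul_const τ₀).add (hasDerivAt_log_zsum ha hb0 β₀)
  rcases hβ1.eq_or_lt with rfl | hβ1
  · have hlt : τ₀ < zvel a b 1 := by
      rw [← hv, zvel_one ha hb0, zvel_one hc hd0]; exact hB.zder_lt
    have hs : ∀ᶠ β in 𝓝[<] (1 : ℝ), β < 1 := self_mem_nhdsWithin
    have hp : ∀ᶠ β in 𝓝[<] (1 : ℝ), 0 < β :=
      mem_nhdsWithin_of_mem_nhds (lt_mem_nhds zero_lt_one)
    obtain ⟨β, hβ, hβ1, hβ0⟩ := ((eventually_left_lt_of_hasDerivAt_pos (hder 1)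
      (by linarith)).and (hs.and hp)).exists
    refine ⟨β, le_of_lt hβ0, le_of_lt hβ1, ?_⟩
    simpa [zsum_one hc hd0, zsum_one ha hb0] using hβ
  rcases hβ0.eq_or_lt with rfl | hβ0
  · by_cases hfull : ∀ x, 0 < a x
    · have hlt : zvel a b 0 < τ₀ := by
        rw [← hv, zvel_zero hfull hb, zvel_zero hc0 hd, zder_zero_eq_neg hfull hb0,
          zder_zero_eq_neg hc0 hd0]
        exact neg_lt_neg (hC hfull).zder_lt
      have hs : ∀ᶠ β in 𝓝[>] (0 : ℝ), 0 < β := self_mem_nhdsWithin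
      have hp : ∀ᶠ β in 𝓝[>] (0 : ℝ), β < 1 :=
        mem_nhdsWithin_of_mem_nhds (gt_mem_nhds zero_lt_one)
      obtain ⟨β, hβ, hβ0, hβ1⟩ := ((eventually_lt_of_hasDerivAt_neg (hder 0)
        (by linarith)).and (hs.and hp)).exists
      refine ⟨β, le_of_lt hβ0, le_of_lt hβ1, ?_⟩
      simpa [zsum_zero hc0 hd, zsum_zero hfull hb] using hβ
    · push Not at hfull
      obtain ⟨x, hx⟩ := hfull
      have h2 := zsum_zero_lt_one hb hb0 ⟨x, le_antisymm hx (ha.1 x)⟩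
      refine ⟨0, le_rfl, zero_le_one, ?_⟩
      have := Real.log_neg (zsum_pos ha hb0 0) h2
      simpa [zsum_zero hc0 hd] using this
  · refine ⟨β₁, hβ0.le, hβ1.le, ?_⟩
    have := Real.log_lt_log (zsum_pos ha hb0 β₁) (hA β₁ hβ0 hβ1)
    linarith

/-- Strict Rényi domination implies large-sample majorization. -/
theorem eventually_exists_stoch_kpow {a b : I → ℝ} {c d : J → ℝ}
    (ha : IsProb a) (hb : IsProb b) (hb0 : ∀ x, 0 < b x)
    (hc : IsProb c) (hc0 : ∀ y, 0 < c y) (hd : IsProb d) (hd0 : ∀ y, 0 < d y)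
    (hA : ∀ β, 0 < β → β < 1 → zsum a b β < zsum c d β) (hB : StrictDom a b c d)
    (hC : (∀ x, 0 < a x) → StrictDom b a d c) :
    ∀ᶠ m in atTop, ∃ T : (Fin m → J) → (Fin m → I) → ℝ, IsStoch T ∧
      (∀ g, ∑ f, T g f * kpow a m f = kpow c m g) ∧
      (∀ g, ∑ f, T g f * kpow b m f = kpow d m g) := by
  obtain ⟨κ, hκ, x₁, hx₁⟩ := hB.max_lt
  obtain ⟨κ', hκ', hlow⟩ : ∃ κ', (∀ y, d y ≤ Real.exp κ' * c y) ∧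
      ∀ τ₀, -κ' ≤ τ₀ → τ₀ < zvel c d 0 → LocallyEventually (HingeLE a b c d) τ₀ := by
    have hv : zvel d c 1 = -zvel c d 0 := by
      rw [zvel_one hd hc0, zvel_zero hc0 hd, zder_zero_eq_neg hc0 hd0, neg_neg]
    by_cases hfull : ∀ x, 0 < a x
    · obtain ⟨κ', hκ', x₂, hx₂⟩ := (hC hfull).max_lt
      refine ⟨κ', hκ', fun τ₀ h1 h2 => locallyEventually_hingeLE_of_swap ha hb hc hd
        ((hC hfull).locallyEventually_hingeLE hb hfull hd hc0 (by linarith) ⟨x₂, ?_⟩)⟩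
      refine lt_of_le_of_lt ?_ hx₂
      exact mul_le_mul_of_nonneg_right (Real.exp_le_exp.2 (by linarith)) (ha.1 _)
    · push Not at hfull
      obtain ⟨x, hx⟩ := hfull
      refine ⟨Real.log (∑ y, d y / c y), fun y => ?_, fun τ₀ _ h2 =>
        locallyEventually_hingeLE_of_swap ha hb hc hd (locallyEventually_hingeLE_of_eq_zero
          hb hb0 hd hc0 (by linarith) ⟨x, le_antisymm hx (ha.1 x)⟩)⟩
      have hle : d y / c y ≤ ∑ y, d y / c y :=
        Finset.single_le_sum (f := fun y => d y / c y)
          (fun y _ => (div_pos (hd0 y) (hc0 y)).le) (Finset.mem_univ y)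
      rw [Real.exp_log ((div_pos (hd0 y) (hc0 y)).trans_le hle)]
      exact (div_le_iff₀ (hc0 y)).1 hle
  have hloc : ∀ τ ∈ Set.Icc (-κ') κ, LocallyEventually (HingeLE a b c d) τ := by
    rintro τ ⟨h1, h2⟩
    rcases lt_or_ge τ (zvel c d 0) with h3 | h3
    · exact hlow τ h1 h3
    rcases lt_or_ge (zvel c d 1) τ with h4 | h4
    · refine hB.locallyEventually_hingeLE ha hb0 hc hd0 h4 ⟨x₁, lt_of_le_of_lt ?_ hx₁⟩
      exact mul_le_mul_of_nonneg_right (Real.exp_le_exp.2 h2) (hb.1 _)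
    · exact locallyEventually_hingeLE_middle ha hb hb0 hc hc0 hd hd0 hA hB hC h3 h4
  have hup : ∀ {K L : Type} [Fintype K] [Fintype L] {a b : K → ℝ} {c d : L → ℝ} {κ τ : ℝ}
      (_ : ∀ y, 0 ≤ c y) (_ : ∀ y, 0 ≤ d y) (_ : ∀ y, c y ≤ Real.exp κ * d y) (_ : κ ≤ τ) (m : ℕ),
      HingeLE a b c d m τ := by
    intro K L _ _ a b c d κ τ hc hd h hκ m
    refine le_trans (le_of_eq ?_) (Finset.sum_nonneg fun f _ => le_max_left _ _)
    refine Finset.sum_eq_zero fun f _ => max_eq_left (sub_nonpos.2 ?_)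
    refine (kpow_le_exp_mul hc h m f).trans (mul_le_mul_of_nonneg_right ?_ (kpow_nonneg hd m f))
    exact Real.exp_le_exp.2 (mul_le_mul_of_nonneg_left hκ (Nat.cast_nonneg m))
  filter_upwards [LocallyEventually.eventually_forall_Icc hloc, eventually_ge_atTop 1] with m hm hm1
  refine exists_stoch_of_hinge_le (ha.kpow m) (hb.kpow m) (hc.kpow m) (hd.kpow m)
    (kpow_pos hb0 m) (kpow_pos hd0 m) fun t ht => ?_
  have hm0 : (m : ℝ) ≠ 0 := by positivity
  have key : HingeLE a b c d m (Real.log t / m) := by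
    rcases le_total (Real.log t / m) (-κ') with h1 | h1
    · exact hingeLE_of_swap ha hb hc hd (hup hd.1 hc.1 hκ' (by linarith) m)
    rcases le_total κ (Real.log t / m) with h2 | h2
    · exact hup hc.1 hd.1 hκ h2 m
    · exact hm _ ⟨h1, h2⟩
  unfold HingeLE at key
  rwa [mul_div_cancel₀ _ hm0, Real.exp_log ht] at key

end Regimes

section PowerSums

theorem rpow_mul_rpow_eq_bernoulli {a b t β : ℝ} (ha : 0 ≤ a) (hb : 0 < b) (ht : 0 < t) :
    a ^ β * b ^ (1 - β) = b * t ^ β * (1 + (a / (b * t) - 1)) ^ β := by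
  rw [add_sub_cancel, Real.div_rpow ha (by positivity), Real.mul_rpow hb.le ht.le,
    Real.rpow_sub hb, Real.rpow_one]
  have h1 := (Real.rpow_pos_of_pos hb β).ne'
  have h2 := (Real.rpow_pos_of_pos ht β).ne'
  field_simp

theorem tangent_eq_bernoulli {a b t β : ℝ} (hb : 0 < b) (ht : 0 < t) :
    β * t ^ (β - 1) * a + (1 - β) * t ^ β * b = b * t ^ β * (1 + β * (a / (b * t) - 1)) := by
  rw [Real.rpow_sub ht, Real.rpow_one]
  field_simp
  ring

theorem tangent_le_rpow_mul_rpow {a b t β : ℝ} (ha : 0 ≤ a) (hb : 0 ≤ b) (hab : b = 0 → a = 0)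
    (ht : 0 < t) (hβ : 1 < β) :
    β * t ^ (β - 1) * a + (1 - β) * t ^ β * b ≤ a ^ β * b ^ (1 - β) := by
  rcases hb.eq_or_lt with rfl | hb
  · rw [hab rfl, Real.zero_rpow (by linarith)]; simp
  rw [rpow_mul_rpow_eq_bernoulli ha hb ht, tangent_eq_bernoulli hb ht]
  have : 0 ≤ a / (b * t) := by positivity
  gcongr
  exact one_add_mul_self_le_rpow_one_add (by linarith) hβ.le

theorem rpow_mul_rpow_le_tangent {a b t β : ℝ} (ha : 0 ≤ a) (hb : 0 ≤ b)
    (ht : 0 < t) (hβ0 : 0 < β) (hβ : β < 1) :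
    a ^ β * b ^ (1 - β) ≤ β * t ^ (β - 1) * a + (1 - β) * t ^ β * b := by
  rcases hb.eq_or_lt with rfl | hb
  · rw [Real.zero_rpow (show (1 : ℝ) - β ≠ 0 by linarith)]
    have : 0 ≤ β * t ^ (β - 1) * a := by positivity
    simpa using this
  rw [rpow_mul_rpow_eq_bernoulli ha hb ht, tangent_eq_bernoulli hb ht]
  have : 0 ≤ a / (b * t) := by positivity
  gcongr
  exact rpow_one_add_le_one_add_mul_self (by linarith) hβ0.le hβ.le

theorem rpow_mul_rpow_nonneg {a b : ℝ} (ha : 0 ≤ a) (hb : 0 ≤ b) (β : ℝ) :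
    0 ≤ a ^ β * b ^ (1 - β) := mul_nonneg (Real.rpow_nonneg ha _) (Real.rpow_nonneg hb _)

theorem rpow_mul_rpow_smul {a b t β : ℝ} (ha : 0 ≤ a) (hb : 0 ≤ b) (ht : 0 ≤ t) (hβ : β ≠ 0) :
    (t * a) ^ β * (t * b) ^ (1 - β) = t * (a ^ β * b ^ (1 - β)) := by
  rcases ht.eq_or_lt with rfl | ht
  · simp [Real.zero_rpow hβ]
  rw [Real.mul_rpow ht.le ha, Real.mul_rpow ht.le hb, Real.rpow_sub ht, Real.rpow_one]
  have := (Real.rpow_pos_of_pos ht β).ne'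
  field_simp

theorem rpow_mul_rpow_self {a : ℝ} (ha : 0 ≤ a) {β : ℝ} (hβ : β ≠ 0) :
    a ^ β * a ^ (1 - β) = a := by
  rcases ha.eq_or_lt with rfl | ha
  · rw [Real.zero_rpow hβ, zero_mul]
  · rw [← Real.rpow_add ha, add_sub_cancel, Real.rpow_one]

variable {I J : Type} [Fintype I] [Fintype J]

/-- The power sum `∑ a^β b^(1-β)`; for `β ∉ {0, 1}` only the common support contributes. -/
def rsum (β : ℝ) (a b : I → ℝ) : ℝ := ∑ x, a x ^ β * b x ^ (1 - β)

theorem rpow_sum_mul_rpow_sum_le {a b : I → ℝ} (ha : ∀ x, 0 ≤ a x) (hb : ∀ x, 0 ≤ b x)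
    (hab : ∀ x, b x = 0 → a x = 0) {β : ℝ} (hβ : 1 < β) :
    (∑ x, a x) ^ β * (∑ x, b x) ^ (1 - β) ≤ rsum β a b := by
  have h0 : 0 ≤ rsum β a b := Finset.sum_nonneg fun x _ => rpow_mul_rpow_nonneg (ha x) (hb x) β
  rcases (Finset.sum_nonneg fun x _ => ha x).eq_or_lt with hA | hA
  · rwa [← hA, Real.zero_rpow (by linarith), zero_mul]
  rcases (Finset.sum_nonneg fun x _ => hb x).eq_or_lt with hB | hB
  · rwa [← hB, Real.zero_rpow (show (1 : ℝ) - β ≠ 0 by linarith), mul_zero]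
  have ht := div_pos hA hB
  have h := Finset.sum_le_sum fun x (_ : x ∈ Finset.univ) =>
    tangent_le_rpow_mul_rpow (ha x) (hb x) (hab x) ht hβ
  rw [Finset.sum_add_distrib, ← Finset.mul_sum, ← Finset.mul_sum] at h
  refine le_trans (le_of_eq ?_) h
  rw [rpow_mul_rpow_eq_bernoulli hA.le hB ht, tangent_eq_bernoulli hB ht,
    mul_div_cancel₀ _ hB.ne', div_self hA.ne']
  simp

theorem rsum_le_rpow_sum_mul_rpow_sum {a b : I → ℝ} (ha : ∀ x, 0 ≤ a x) (hb : ∀ x, 0 ≤ b x)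
    {β : ℝ} (hβ0 : 0 < β) (hβ : β < 1) :
    rsum β a b ≤ (∑ x, a x) ^ β * (∑ x, b x) ^ (1 - β) := by
  rcases (Finset.sum_nonneg fun x _ => ha x).eq_or_lt with hA | hA
  · have h0 := (Finset.sum_eq_zero_iff_of_nonneg fun x _ => ha x).1 hA.symm
    rw [← hA, Real.zero_rpow hβ0.ne', zero_mul]
    refine (Finset.sum_eq_zero fun x hx => ?_).le
    rw [h0 x hx, Real.zero_rpow hβ0.ne', zero_mul]
  rcases (Finset.sum_nonneg fun x _ => hb x).eq_or_lt with hB | hB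
  · have h0 := (Finset.sum_eq_zero_iff_of_nonneg fun x _ => hb x).1 hB.symm
    have h1 : (1 : ℝ) - β ≠ 0 := by linarith
    rw [← hB, Real.zero_rpow h1, mul_zero]
    refine (Finset.sum_eq_zero fun x hx => ?_).le
    rw [h0 x hx, Real.zero_rpow h1, mul_zero]
  have ht := div_pos hA hB
  have h := Finset.sum_le_sum fun x (_ : x ∈ Finset.univ) =>
    rpow_mul_rpow_le_tangent (ha x) (hb x) ht hβ0 hβ
  rw [Finset.sum_add_distrib, ← Finset.mul_sum, ← Finset.mul_sum] at h
  refine h.trans (le_of_eq ?_)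
  rw [rpow_mul_rpow_eq_bernoulli hA.le hB ht, tangent_eq_bernoulli hB ht,
    mul_div_cancel₀ _ hB.ne', div_self hA.ne']
  simp

theorem rsum_le_of_stoch {T : J → I → ℝ} (hT : IsStoch T) {a b : I → ℝ} (ha : ∀ x, 0 ≤ a x)
    (hb : ∀ x, 0 ≤ b x) (hab : ∀ x, b x = 0 → a x = 0) {β : ℝ} (hβ : 1 < β) :
    rsum β (fun y => ∑ x, T y x * a x) (fun y => ∑ x, T y x * b x) ≤ rsum β a b := by
  calc _ ≤ ∑ y, ∑ x, T y x * (a x ^ β * b x ^ (1 - β)) := by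
        refine Finset.sum_le_sum fun y _ => (rpow_sum_mul_rpow_sum_le
          (fun x => mul_nonneg (hT.1 y x) (ha x)) (fun x => mul_nonneg (hT.1 y x) (hb x))
          (fun x hx => ?_) hβ).trans (le_of_eq (Finset.sum_congr rfl fun x _ =>
            rpow_mul_rpow_smul (ha x) (hb x) (hT.1 y x) (by linarith)))
        rcases mul_eq_zero.1 hx with h | h
        · rw [h, zero_mul]
        · rw [hab x h, mul_zero]
    _ = rsum β a b := by
        rw [Finset.sum_comm]
        exact Finset.sum_congr rfl fun x _ => by rw [← Finset.sum_mul, hT.2, one_mul]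

theorem rsum_ge_of_stoch {T : J → I → ℝ} (hT : IsStoch T) {a b : I → ℝ} (ha : ∀ x, 0 ≤ a x)
    (hb : ∀ x, 0 ≤ b x) {β : ℝ} (hβ0 : 0 < β) (hβ : β < 1) :
    rsum β a b ≤ rsum β (fun y => ∑ x, T y x * a x) (fun y => ∑ x, T y x * b x) := by
  calc rsum β a b = ∑ y, ∑ x, T y x * (a x ^ β * b x ^ (1 - β)) := by
        rw [Finset.sum_comm]
        exact Finset.sum_congr rfl fun x _ => by rw [← Finset.sum_mul, hT.2, one_mul]
    _ ≤ _ := Finset.sum_le_sum fun y _ => (le_of_eq (Finset.sum_congr rfl fun x _ =>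
            (rpow_mul_rpow_smul (ha x) (hb x) (hT.1 y x) hβ0.ne').symm)).trans
          (rsum_le_rpow_sum_mul_rpow_sum (fun x => mul_nonneg (hT.1 y x) (ha x))
            (fun x => mul_nonneg (hT.1 y x) (hb x)) hβ0 hβ)

theorem rsum_swap (β : ℝ) (a b : I → ℝ) : rsum (1 - β) b a = rsum β a b :=
  Finset.sum_congr rfl fun x _ => by rw [sub_sub_cancel, mul_comm]

theorem rsum_kron {a b : I → ℝ} {c d : J → ℝ} (ha : ∀ x, 0 ≤ a x) (hb : ∀ x, 0 ≤ b x)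
    (hc : ∀ x, 0 ≤ c x) (hd : ∀ x, 0 ≤ d x) (β : ℝ) :
    rsum β (kron a c) (kron b d) = rsum β a b * rsum β c d := by
  unfold rsum kron
  rw [Fintype.sum_mul_sum, Fintype.sum_prod_type]
  refine Finset.sum_congr rfl fun x _ => Finset.sum_congr rfl fun y _ => ?_
  rw [Real.mul_rpow (ha x) (hc y), Real.mul_rpow (hb x) (hd y)]
  ring

theorem rsum_pos {a b : I → ℝ} (ha : ∀ x, 0 ≤ a x) (hb : ∀ x, 0 ≤ b x)
    (h : ∃ x, a x ≠ 0 ∧ b x ≠ 0) (β : ℝ) : 0 < rsum β a b := by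
  obtain ⟨x, h1, h2⟩ := h
  refine Finset.sum_pos' (fun x _ => rpow_mul_rpow_nonneg (ha x) (hb x) β) ⟨x, Finset.mem_univ x,
    mul_pos (Real.rpow_pos_of_pos ((ha x).lt_of_ne' h1) _)
      (Real.rpow_pos_of_pos ((hb x).lt_of_ne' h2) _)⟩

theorem zsum_eq_rsum {a b : I → ℝ} (ha : ∀ x, 0 ≤ a x) (hb : ∀ x, 0 < b x) {β : ℝ} (hβ : β ≠ 0) :
    zsum a b β = rsum β a b := by
  refine Finset.sum_congr rfl fun x _ => ?_
  split_ifs with h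
  · rw [h, Real.zero_rpow hβ]; simp
  · have h' := (ha x).lt_of_ne' h
    rw [Real.log_div h'.ne' (hb x).ne', Real.rpow_def_of_pos h', Real.rpow_def_of_pos (hb x),
      ← Real.exp_add]
    nth_rw 1 [← Real.exp_log (hb x)]
    rw [← Real.exp_add]
    congr 1; ring

theorem rsum_mix_le {a b s : I → ℝ} (ha : ∀ x, 0 ≤ a x) (hb : ∀ x, 0 < b x)
    (hs : IsProb s) {e : ℝ} (he : 0 < e) (he1 : e < 1) {β : ℝ} (hβ : 1 < β) :
    rsum β (fun x => (1 - e) * a x + e * s x) (fun x => (1 - e) * b x + e * s x) ≤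
      (1 - e) * rsum β a b + e := by
  have h1 : 0 < 1 - e := by linarith
  have hβ0 : β ≠ 0 := by linarith
  have key : ∀ x, ((1 - e) * a x + e * s x) ^ β * ((1 - e) * b x + e * s x) ^ (1 - β) ≤
      (1 - e) * (a x ^ β * b x ^ (1 - β)) + e * s x := by
    intro x
    have h := rpow_sum_mul_rpow_sum_le (I := Fin 2) (a := ![(1 - e) * a x, e * s x])
      (b := ![(1 - e) * b x, e * s x]) ?_ ?_ ?_ hβ
    · simp only [rsum, Fin.sum_univ_two, Matrix.cons_val_zero, Matrix.cons_val_one] at h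
      rwa [rpow_mul_rpow_smul (ha x) (hb x).le h1.le hβ0,
        rpow_mul_rpow_smul (hs.1 x) (hs.1 x) he.le hβ0, rpow_mul_rpow_self (hs.1 x) hβ0] at h
    all_goals
      have := ha x; have := hb x; have := hs.1 x
      intro i; fin_cases i
    · simp; positivity
    · simp; positivity
    · simp; positivity
    · simp; positivity
    · intro h; have : 0 < (1 - e) * b x := by positivity
      simp at h; rcases h with h | h <;> linarith
    · exact fun h => h
  refine (Finset.sum_le_sum fun x _ => key x).trans (le_of_eq ?_)
  rw [Finset.sum_add_distrib, ← Finset.mul_sum, ← Finset.mul_sum, hs.2, mul_one]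
  rfl

theorem le_rsum_mix {a b s : I → ℝ} (ha : ∀ x, 0 ≤ a x) (hb : ∀ x, 0 ≤ b x)
    (hs : IsProb s) {e : ℝ} (he : 0 < e) (he1 : e < 1) {β : ℝ} (hβ0 : 0 < β) (hβ : β < 1) :
    (1 - e) * rsum β a b + e ≤
      rsum β (fun x => (1 - e) * a x + e * s x) (fun x => (1 - e) * b x + e * s x) := by
  have h1 : 0 < 1 - e := by linarith
  have key : ∀ x, (1 - e) * (a x ^ β * b x ^ (1 - β)) + e * s x ≤
      ((1 - e) * a x + e * s x) ^ β * ((1 - e) * b x + e * s x) ^ (1 - β) := by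
    intro x
    have h := rsum_le_rpow_sum_mul_rpow_sum (I := Fin 2) (a := ![(1 - e) * a x, e * s x])
      (b := ![(1 - e) * b x, e * s x]) ?_ ?_ hβ0 hβ
    · simp only [rsum, Fin.sum_univ_two, Matrix.cons_val_zero, Matrix.cons_val_one] at h
      rwa [rpow_mul_rpow_smul (ha x) (hb x) h1.le hβ0.ne',
        rpow_mul_rpow_smul (hs.1 x) (hs.1 x) he.le hβ0.ne', rpow_mul_rpow_self (hs.1 x) hβ0.ne'] at h
    all_goals
      have := ha x; have := hb x; have := hs.1 x
      intro i; fin_cases i <;> simp <;> positivity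
  refine le_trans (le_of_eq ?_) (Finset.sum_le_sum fun x _ => key x)
  rw [Finset.sum_add_distrib, ← Finset.mul_sum, ← Finset.mul_sum, hs.2, mul_one]
  rfl

theorem one_lt_rsum {a b : I → ℝ} (ha : IsProb a) (hb : IsProb b) (hb0 : ∀ x, 0 < b x)
    (hne : a ≠ b) {β : ℝ} (hβ : 1 < β) : 1 < rsum β a b := by
  obtain ⟨x, hx⟩ := Function.ne_iff.1 hne
  have h : ∑ x, (β * a x + (1 - β) * b x) = 1 := by
    rw [Finset.sum_add_distrib, ← Finset.mul_sum, ← Finset.mul_sum, ha.2, hb.2]; ring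
  rw [← h]
  refine Finset.sum_lt_sum (fun y _ => ?_) ⟨x, Finset.mem_univ x, ?_⟩
  · simpa using tangent_le_rpow_mul_rpow (ha.1 y) (hb.1 y) (fun h => ((hb0 y).ne' h).elim)
      one_pos hβ
  · have e := tangent_eq_bernoulli (a := a x) (β := β) (hb0 x) one_pos
    have h0 : 0 ≤ a x / b x := div_nonneg (ha.1 x) (hb.1 x)
    rw [rpow_mul_rpow_eq_bernoulli (ha.1 x) (hb0 x) one_pos]
    simp only [Real.one_rpow, mul_one] at e ⊢
    rw [e]
    refine mul_lt_mul_of_pos_left (one_add_mul_self_lt_rpow_one_add (by linarith) ?_ hβ) (hb0 x)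
    rw [sub_ne_zero, Ne, div_eq_one_iff_eq (hb0 x).ne']
    exact hx

theorem rsum_lt_one {a b : I → ℝ} (ha : IsProb a) (hb : IsProb b) (hb0 : ∀ x, 0 < b x)
    (hne : a ≠ b) {β : ℝ} (hβ0 : 0 < β) (hβ : β < 1) : rsum β a b < 1 := by
  obtain ⟨x, hx⟩ := Function.ne_iff.1 hne
  have h : ∑ x, (β * a x + (1 - β) * b x) = 1 := by
    rw [Finset.sum_add_distrib, ← Finset.mul_sum, ← Finset.mul_sum, ha.2, hb.2]; ring
  rw [← h]
  refine Finset.sum_lt_sum (fun y _ => ?_) ⟨x, Finset.mem_univ x, ?_⟩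
  · simpa using rpow_mul_rpow_le_tangent (ha.1 y) (hb.1 y) one_pos hβ0 hβ
  · have e := tangent_eq_bernoulli (a := a x) (β := β) (hb0 x) one_pos
    have h0 : 0 ≤ a x / b x := div_nonneg (ha.1 x) (hb.1 x)
    rw [rpow_mul_rpow_eq_bernoulli (ha.1 x) (hb0 x) one_pos]
    simp only [Real.one_rpow, mul_one] at e ⊢
    rw [e]
    refine mul_lt_mul_of_pos_left (rpow_one_add_lt_one_add_mul_self (by linarith) ?_ hβ0 hβ) (hb0 x)
    rw [sub_ne_zero, Ne, div_eq_one_iff_eq (hb0 x).ne']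
    exact hx

theorem zder_one_pos {a b : I → ℝ} (ha : IsProb a) (hb : IsProb b) (hb0 : ∀ x, 0 < b x)
    (hne : a ≠ b) : 0 < zder a b 1 := by
  obtain ⟨x, hx⟩ := Function.ne_iff.1 hne
  have h : ∑ x, (a x - b x) = 0 := by rw [Finset.sum_sub_distrib, ha.2, hb.2, sub_self]
  have key : ∀ y, a y ≠ b y → a y - b y < a y * Real.log (a y / b y) := by
    intro y hy
    rcases (ha.1 y).eq_or_lt with h0 | h0
    · rw [← h0]; simpa using hb0 y
    · have h1 := Real.log_lt_sub_one_of_pos (div_pos (hb0 y) h0)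
        (fun h => hy ((div_eq_one_iff_eq h0.ne').1 h).symm)
      rw [← inv_div, Real.log_inv]
      have h2 := mul_lt_mul_of_pos_left h1 h0
      rw [mul_sub, mul_div_cancel₀ _ h0.ne'] at h2
      linarith
  rw [zder_one ha.1 hb0, ← h]
  refine Finset.sum_lt_sum (fun y _ => ?_) ⟨x, Finset.mem_univ x, key x hx⟩
  by_cases hy : a y = b y
  · rw [hy, div_self (hb0 y).ne']; simp
  · exact (key y hy).le

theorem zder_one_le_of_zsum_le {a b : I → ℝ} {c d : J → ℝ} (ha : IsProb a) (hb0 : ∀ x, 0 < b x)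
    (hc : IsProb c) (hd0 : ∀ x, 0 < d x) {e : ℝ}
    (h : ∀ β, 1 < β → zsum c d β ≤ (1 - e) * zsum a b β + e) :
    zder c d 1 ≤ (1 - e) * zder a b 1 := by
  by_contra hlt
  push Not at hlt
  have hd : HasDerivAt (fun β => ((1 - e) * zsum a b β + e) - zsum c d β)
      ((1 - e) * zder a b 1 - zder c d 1) 1 :=
    (((hasDerivAt_zsum a b 1).const_mul _).add_const _).sub (hasDerivAt_zsum c d 1)
  have hs : ∀ᶠ β in 𝓝[>] (1 : ℝ), 1 < β := self_mem_nhdsWithin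
  obtain ⟨β, hβ, hβ1⟩ := ((eventually_lt_of_hasDerivAt_neg hd (by linarith)).and hs).exists
  rw [zsum_one ha hb0, zsum_one hc hd0] at hβ
  linarith [h β hβ1]

/-- Domination of all power sums of order above one bounds the likelihood ratios. -/
theorem le_mul_of_rsum_le {a b : I → ℝ} {c d : J → ℝ} (ha : IsProb a) (hb0 : ∀ x, 0 < b x)
    (hc : ∀ y, 0 ≤ c y) (hd0 : ∀ x, 0 < d x) (h : ∀ β, 1 < β → rsum β c d ≤ rsum β a b)
    {M : ℝ} (hM0 : 0 < M) (hM : ∀ x, a x ≤ M * b x) (y : J) : c y ≤ M * d y := by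
  by_contra hlt
  push Not at hlt
  have hcy : 0 < c y := (mul_pos hM0 (hd0 y)).trans hlt
  have hr : 1 < c y / d y / M := by rw [lt_div_iff₀ hM0, lt_div_iff₀ (hd0 y)]; linarith
  obtain ⟨k, hk⟩ := pow_unbounded_of_one_lt (1 / c y) hr
  have e : ∀ {u v : ℝ}, 0 ≤ u → 0 < v → u ^ ((k : ℝ) + 2) * v ^ (1 - ((k : ℝ) + 2)) =
      (u / v) ^ (k + 1) * u := by
    intro u v hu hv
    have e1 : (k : ℝ) + 2 = ((k + 2 : ℕ) : ℝ) := by push_cast; ring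
    have e2 : 1 - ((k : ℝ) + 2) = -((k + 1 : ℕ) : ℝ) := by push_cast; ring
    rw [e2, e1, Real.rpow_neg hv.le, Real.rpow_natCast, Real.rpow_natCast, div_pow]
    field_simp
    ring
  have h1 : rsum ((k : ℝ) + 2) a b ≤ M ^ (k + 1) := by
    rw [← mul_one (M ^ (k + 1)), ← ha.2, Finset.mul_sum]
    refine Finset.sum_le_sum fun x _ => ?_
    rw [e (ha.1 x) (hb0 x)]
    have := ha.1 x
    have h2 : a x / b x ≤ M := (div_le_iff₀ (hb0 x)).2 (hM x)
    have h3 : 0 ≤ a x / b x := div_nonneg this (hb0 x).le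
    gcongr
  have h2 : (c y / d y) ^ (k + 1) * c y ≤ rsum ((k : ℝ) + 2) c d := by
    rw [← e hcy.le (hd0 y)]
    exact Finset.single_le_sum (f := fun y => c y ^ ((k : ℝ) + 2) * d y ^ (1 - ((k : ℝ) + 2)))
      (fun z _ => rpow_mul_rpow_nonneg (hc z) (hd0 z).le _) (Finset.mem_univ y)
  have h3 := h2.trans ((h _ (by have := k.cast_nonneg (α := ℝ); linarith)).trans h1)
  have h4 : 1 < (c y / d y / M) ^ (k + 1) * c y := by
    rw [div_lt_iff₀ hcy] at hk
    refine hk.trans_le (mul_le_mul_of_nonneg_right ?_ hcy.le)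
    exact pow_le_pow_right₀ hr.le (Nat.le_succ k)
  rw [div_pow, div_mul_eq_mul_div, lt_div_iff₀ (pow_pos hM0 _)] at h4
  linarith

theorem exists_lt_of_ne {a b : I → ℝ} (ha : IsProb a) (hb : IsProb b) (hne : a ≠ b) :
    ∃ x, b x < a x := by
  by_contra hcon
  push Not at hcon
  exact hne (funext fun x => (Finset.sum_eq_sum_iff_of_le fun x _ => hcon x).1
    (ha.2.trans hb.2.symm) x (Finset.mem_univ x))

/-- Mixing a common full-support component into a dominated dichotomy makes the domination
strict. -/
theorem strictDom_mix {a b : I → ℝ} {c d s : J → ℝ} (ha : IsProb a) (hb : IsProb b)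
    (hb0 : ∀ x, 0 < b x) (hne : a ≠ b) (hc : IsProb c) (hd0 : ∀ x, 0 < d x)
    (hs : IsProb s) (hs0 : ∀ y, 0 < s y) {e : ℝ} (he : 0 < e) (he1 : e < 1)
    (h : ∀ β, 1 < β → rsum β c d ≤ rsum β a b) :
    StrictDom a b (fun y => (1 - e) * c y + e * s y) (fun y => (1 - e) * d y + e * s y) := by
  have h1 : 0 < 1 - e := by linarith
  have hc' : IsProb (fun y => (1 - e) * c y + e * s y) := by
    refine ⟨fun y => ?_, ?_⟩
    · have := hc.1 y; have := hs.1 y; positivity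
    · rw [Finset.sum_add_distrib, ← Finset.mul_sum, ← Finset.mul_sum, hc.2, hs.2]; ring
  have hd' : ∀ y, 0 < (1 - e) * d y + e * s y := fun y => by
    have := hd0 y; have := hs0 y; positivity
  have hz : ∀ β, 1 < β → zsum (fun y => (1 - e) * c y + e * s y)
      (fun y => (1 - e) * d y + e * s y) β ≤ (1 - e) * zsum a b β + e := by
    intro β hβ
    rw [zsum_eq_rsum hc'.1 hd' (by linarith), zsum_eq_rsum ha.1 hb0 (by linarith)]
    refine (rsum_mix_le hc.1 hd0 hs he he1 hβ).trans ?_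
    gcongr
    exact h β hβ
  refine ⟨fun β hβ => (hz β hβ).trans_lt ?_, ?_, ?_⟩
  · have := one_lt_rsum ha hb hb0 hne hβ
    rw [zsum_eq_rsum ha.1 hb0 (by linarith)]
    nlinarith
  · have := zder_one_le_of_zsum_le ha hb0 hc' hd' hz
    nlinarith [zder_one_pos ha hb hb0 hne]
  · obtain ⟨x₀, hx₀⟩ := exists_lt_of_ne ha hb hne
    obtain ⟨x, -, hx⟩ := Finset.exists_max_image Finset.univ (fun x => a x / b x)
      ⟨x₀, Finset.mem_univ _⟩
    set M := a x / b x with hMdef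
    have hM : ∀ z, a z ≤ M * b z := fun z => (div_le_iff₀ (hb0 z)).1 (hx z (Finset.mem_univ z))
    have hM1 : 1 < M := lt_of_lt_of_le ((one_lt_div (hb0 _)).2 hx₀) (hx x₀ (Finset.mem_univ _))
    have hcd := le_mul_of_rsum_le ha hb0 hc.1 hd0 h (by linarith) hM
    have hev : ∀ᶠ M' in 𝓝[<] M, ∀ y, (1 - e) * (M - M') * d y < e * (M' - 1) * s y := by
      refine eventually_all.2 fun y => mem_nhdsWithin_of_mem_nhds ?_
      refine ContinuousAt.eventually_lt (by fun_prop) (by fun_prop) ?_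
      have := hs0 y
      have : 0 < M - 1 := by linarith
      simp only [sub_self, mul_zero, zero_mul]
      positivity
    have hlt : ∀ᶠ M' in 𝓝[<] M, M' < M := self_mem_nhdsWithin
    have hgt : ∀ᶠ M' in 𝓝[<] M, 1 < M' := mem_nhdsWithin_of_mem_nhds (lt_mem_nhds hM1)
    obtain ⟨M', hM', hM'M, hM'1⟩ := (hev.and (hlt.and hgt)).exists
    refine ⟨Real.log M', fun y => ?_, x, ?_⟩
    · rw [Real.exp_log (by linarith)]
      have := mul_le_mul_of_nonneg_left (hcd y) h1.le
      linarith [hM' y]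
    · rw [Real.exp_log (by linarith), ← lt_div_iff₀ (hb0 x)]
      exact hM'M

end PowerSums

section Renyi
variable {I J : Type} [Fintype I] [Fintype J]

/-- Domination of `(q₁, q₂)` by `(p₁, p₂)` in terms of power sums. -/
structure RsumDom (p₁ p₂ : I → ℝ) (q₁ q₂ : J → ℝ) : Prop where
  le_of_lt_one : ∀ β, 0 < β → β < 1 → rsum β p₁ p₂ ≤ rsum β q₁ q₂
  le_of_one_lt : ∀ β, 1 < β → rsum β q₁ q₂ ≤ rsum β p₁ p₂
  full : (∀ x, p₁ x ≠ 0) → ∀ y, q₁ y ≠ 0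
  swap_le : (∀ x, p₁ x ≠ 0) → ∀ β, 1 < β → rsum β q₂ q₁ ≤ rsum β p₂ p₁

theorem renyi_of_lt_one {a b : I → ℝ} (h : ∃ x, a x ≠ 0 ∧ b x ≠ 0) {α : ℝ} (h0 : 0 < α)
    (h1 : α < 1) : renyi α a b = (((α - 1)⁻¹ * Real.log (rsum α a b) : ℝ) : EReal) := by
  rw [renyi, if_neg (not_not.2 h), if_neg h0.ne', if_pos h1, Finset.sum_filter_of_ne]
  · rfl
  · intro x _ hx
    refine ⟨fun h => hx ?_, fun h => hx ?_⟩
    · rw [h, Real.zero_rpow h0.ne', zero_mul]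
    · rw [h, Real.zero_rpow (by linarith), mul_zero]

theorem renyi_of_one_lt {a b : I → ℝ} (h : ∃ x, a x ≠ 0 ∧ b x ≠ 0) {α : ℝ}
    (hab : ∀ x, a x ≠ 0 → b x ≠ 0) (h1 : 1 < α) :
    renyi α a b = (((α - 1)⁻¹ * Real.log (rsum α a b) : ℝ) : EReal) := by
  rw [renyi, if_neg (not_not.2 h), if_neg (by linarith), if_neg (by linarith),
    if_neg (by linarith), if_pos hab, Finset.sum_filter_of_ne]
  · rfl
  · intro x _ hx h
    exact hx (by rw [h, Real.zero_rpow (by linarith), zero_mul])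

theorem renyi_one {a b : I → ℝ} (h : ∃ x, a x ≠ 0 ∧ b x ≠ 0) (ha : ∀ x, 0 ≤ a x)
    (hb : ∀ x, 0 < b x) : renyi 1 a b = ((zder a b 1 : ℝ) : EReal) := by
  rw [renyi, if_neg (not_not.2 h), if_neg one_ne_zero, if_neg (lt_irrefl _), if_pos rfl,
    if_pos fun x _ => (hb x).ne', zder_one ha hb, Finset.sum_filter_of_ne]
  intro x _ hx h
  exact hx (by rw [h, zero_mul])

theorem renyi_eq_top {a b : I → ℝ} (hab : ¬ ∀ x, a x ≠ 0 → b x ≠ 0) {α : ℝ} (h1 : 1 ≤ α) :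
    renyi α a b = ⊤ := by
  rw [renyi]
  split_ifs <;> first | rfl | (exfalso; linarith)

theorem rsumDom_iff_renyi_le {p₁ p₂ : I → ℝ} {q₁ q₂ : J → ℝ} (hp₁ : IsProb p₁) (hp₂ : IsProb p₂)
    (hq₁ : IsProb q₁) (hq₂ : IsProb q₂) (hp0 : ∀ x, 0 < p₂ x) (hq0 : ∀ y, 0 < q₂ y) :
    (∀ α : ℝ, 1 / 2 ≤ α →
        renyi α q₁ q₂ ≤ renyi α p₁ p₂ ∧ renyi α q₂ q₁ ≤ renyi α p₂ p₁) ↔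
      RsumDom p₁ p₂ q₁ q₂ := by
  have hp : ∃ x, p₁ x ≠ 0 ∧ p₂ x ≠ 0 := hp₁.exists_ne_zero.imp fun x h => ⟨h, (hp0 x).ne'⟩
  have hq : ∃ x, q₁ x ≠ 0 ∧ q₂ x ≠ 0 := hq₁.exists_ne_zero.imp fun x h => ⟨h, (hq0 x).ne'⟩
  have hp' : ∃ x, p₂ x ≠ 0 ∧ p₁ x ≠ 0 := hp.imp fun _ => And.symm
  have hq' : ∃ x, q₂ x ≠ 0 ∧ q₁ x ≠ 0 := hq.imp fun _ => And.symm
  have hpp := rsum_pos hp₁.1 hp₂.1 hp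
  have hqp := rsum_pos hq₁.1 hq₂.1 hq
  have hpp' := rsum_pos hp₂.1 hp₁.1 hp'
  have hqp' := rsum_pos hq₂.1 hq₁.1 hq'
  have hlow : ∀ {α x y : ℝ}, α < 1 → 0 < x → 0 < y →
      ((α - 1)⁻¹ * Real.log y ≤ (α - 1)⁻¹ * Real.log x ↔ x ≤ y) := fun hα hx hy => by
    rw [mul_le_mul_left_of_neg (inv_lt_zero.2 (by linarith)), Real.log_le_log_iff hx hy]
  have hhigh : ∀ {α x y : ℝ}, 1 < α → 0 < x → 0 < y →
      ((α - 1)⁻¹ * Real.log y ≤ (α - 1)⁻¹ * Real.log x ↔ y ≤ x) := fun hα hx hy => by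
    rw [mul_le_mul_iff_right₀ (inv_pos.2 (by linarith)), Real.log_le_log_iff hy hx]
  constructor
  · intro h
    have hfull : (∀ x, p₁ x ≠ 0) → ∀ y, q₁ y ≠ 0 := by
      intro hf
      by_contra hcon
      have h2 := (h 2 (by norm_num)).2
      rw [renyi_eq_top (fun hh => hcon fun y => hh y (hq0 y).ne') one_le_two, top_le_iff,
        renyi_of_one_lt hp' (fun x _ => hf x) one_lt_two] at h2
      exact EReal.coe_ne_top _ h2
    refine ⟨fun β h0 h1 => ?_, fun β h1 => ?_, hfull, fun hf β h1 => ?_⟩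
    · rcases le_or_gt (1 / 2) β with hβ | hβ
      · have h2 := (h β hβ).1
        rwa [renyi_of_lt_one hp h0 h1, renyi_of_lt_one hq h0 h1, EReal.coe_le_coe_iff,
          hlow h1 (hpp β) (hqp β)] at h2
      · have h2 := (h (1 - β) (by linarith)).2
        rwa [renyi_of_lt_one hp' (by linarith) (by linarith),
          renyi_of_lt_one hq' (by linarith) (by linarith), EReal.coe_le_coe_iff,
          hlow (by linarith) (hpp' _) (hqp' _), rsum_swap, rsum_swap] at h2
    · have h2 := (h β (by linarith)).1
      rwa [renyi_of_one_lt hp (fun x _ => (hp0 x).ne') h1,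
        renyi_of_one_lt hq (fun x _ => (hq0 x).ne') h1, EReal.coe_le_coe_iff,
        hhigh h1 (hpp β) (hqp β)] at h2
    · have h2 := (h β (by linarith)).2
      rwa [renyi_of_one_lt hp' (fun x _ => hf x) h1,
        renyi_of_one_lt hq' (fun x _ => hfull hf x) h1, EReal.coe_le_coe_iff,
        hhigh h1 (hpp' β) (hqp' β)] at h2
  · intro h α hα
    rcases lt_or_ge α 1 with h1 | h1
    · have h0 : 0 < α := by linarith
      rw [renyi_of_lt_one hp h0 h1, renyi_of_lt_one hq h0 h1, renyi_of_lt_one hp' h0 h1,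
        renyi_of_lt_one hq' h0 h1, EReal.coe_le_coe_iff, EReal.coe_le_coe_iff,
        hlow h1 (hpp α) (hqp α), hlow h1 (hpp' α) (hqp' α)]
      refine ⟨h.le_of_lt_one α h0 h1, ?_⟩
      rw [← rsum_swap, ← rsum_swap _ q₂]
      exact h.le_of_lt_one _ (by linarith) (by linarith)
    have hder : ∀ {K L : Type} [Fintype K] [Fintype L] {a b : K → ℝ} {c d : L → ℝ}
        (_ : IsProb a) (_ : ∀ x, 0 < b x) (_ : IsProb c) (_ : ∀ y, 0 < d y)
        (_ : ∀ β, 1 < β → rsum β c d ≤ rsum β a b), zder c d 1 ≤ zder a b 1 := by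
      intro K L _ _ a b c d ha hb hc hd hle
      simpa using zder_one_le_of_zsum_le ha hb hc hd (e := 0) fun β hβ => by
        rw [zsum_eq_rsum ha.1 hb (by linarith), zsum_eq_rsum hc.1 hd (by linarith)]
        simpa using hle β hβ
    constructor
    · rcases h1.eq_or_lt with rfl | h1
      · rw [renyi_one hp hp₁.1 hp0, renyi_one hq hq₁.1 hq0, EReal.coe_le_coe_iff]
        exact hder hp₁ hp0 hq₁ hq0 h.le_of_one_lt
      · rw [renyi_of_one_lt hp (fun x _ => (hp0 x).ne') h1,
          renyi_of_one_lt hq (fun x _ => (hq0 x).ne') h1, EReal.coe_le_coe_iff,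
          hhigh h1 (hpp α) (hqp α)]
        exact h.le_of_one_lt α h1
    · by_cases hf : ∀ x, p₁ x ≠ 0
      · have hfq := h.full hf
        rcases h1.eq_or_lt with rfl | h1
        · have hp1 : ∀ x, 0 < p₁ x := fun x => (hp₁.1 x).lt_of_ne' (hf x)
          have hq1 : ∀ x, 0 < q₁ x := fun x => (hq₁.1 x).lt_of_ne' (hfq x)
          rw [renyi_one hp' hp₂.1 hp1, renyi_one hq' hq₂.1 hq1, EReal.coe_le_coe_iff]
          exact hder hp₂ hp1 hq₂ hq1 (h.swap_le hf)
        · rw [renyi_of_one_lt hp' (fun x _ => hf x) h1, renyi_of_one_lt hq' (fun x _ => hfq x) h1,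
            EReal.coe_le_coe_iff, hhigh h1 (hpp' α) (hqp' α)]
          exact h.swap_le hf α h1
      · rw [renyi_eq_top (fun hh => hf fun x => hh x (hp0 x).ne') h1]
        exact le_top

theorem RsumDom.condLS {p₁ p₂ : I → ℝ} {q₁ q₂ : J → ℝ} (h : RsumDom p₁ p₂ q₁ q₂)
    (hp₁ : IsProb p₁) (hp₂ : IsProb p₂) (hq₁ : IsProb q₁) (hq₂ : IsProb q₂)
    (hp0 : ∀ x, 0 < p₂ x) (hq0 : ∀ y, 0 < q₂ y) (hne : p₁ ≠ p₂) :
    CondLS p₁ p₂ q₁ q₂ (fun r => r = q₂) := by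
  intro ε hε
  set e := min (ε / 2) (1 / 2) with he_def
  have he : 0 < e := by positivity
  have he1 : e < 1 := (min_le_right _ _).trans_lt (by norm_num)
  have he2 : e ≤ ε / 2 := min_le_left _ _
  have h1 : 0 < 1 - e := by linarith
  have hmix : (fun y => (1 - e) * q₂ y + e * q₂ y) = q₂ := by funext y; ring
  set qe : J → ℝ := fun y => (1 - e) * q₁ y + e * q₂ y with hqe
  have hqe0 : ∀ y, 0 < qe y := fun y => by
    have := hq₁.1 y; have := hq0 y; simp only [qe]; positivity
  have hqep : IsProb qe := by
    refine ⟨fun y => (hqe0 y).le, ?_⟩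
    simp only [qe]
    rw [Finset.sum_add_distrib, ← Finset.mul_sum, ← Finset.mul_sum, hq₁.2, hq₂.2]; ring
  refine ⟨qe, q₂, ⟨hqep, hq₂, fun y _ => (hq0 y).ne'⟩, ?_, ?_, rfl, ?_⟩
  · calc dist1 q₁ qe ≤ ∑ y, e * (q₁ y + q₂ y) := by
          refine Finset.sum_le_sum fun y _ => ?_
          have e1 : q₁ y - qe y = e * (q₁ y - q₂ y) := by simp only [qe]; ring
          rw [e1, abs_mul, abs_of_pos he]
          refine mul_le_mul_of_nonneg_left (abs_le.2 ⟨?_, ?_⟩) he.le <;>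
            linarith [hq₁.1 y, hq₂.1 y]
      _ ≤ ε := by rw [← Finset.mul_sum, Finset.sum_add_distrib, hq₁.2, hq₂.2]; linarith
  · simpa [dist1] using hε.le
  · refine eventually_atTop.1 (eventually_exists_stoch_kpow hp₁ hp₂ hp0 hqep hqe0 hq₂ hq0
      (fun β hβ0 hβ1 => ?_) ?_ fun hp1 => ?_)
    · rw [zsum_eq_rsum hp₁.1 hp0 hβ0.ne', zsum_eq_rsum hqep.1 hq0 hβ0.ne']
      have h2 := le_rsum_mix hq₁.1 hq₂.1 hq₂ he he1 hβ0 hβ1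
      rw [hmix] at h2
      refine lt_of_lt_of_le ?_ h2
      nlinarith [rsum_lt_one hp₁ hp₂ hp0 hne hβ0 hβ1, h.le_of_lt_one β hβ0 hβ1]
    · have h2 := strictDom_mix hp₁ hp₂ hp0 hne hq₁ hq0 hq₂ hq0 he he1 h.le_of_one_lt
      rwa [hmix] at h2
    · have hf : ∀ x, p₁ x ≠ 0 := fun x => (hp1 x).ne'
      have h2 := strictDom_mix hp₂ hp₁ hp1 hne.symm hq₂
        (fun y => (hq₁.1 y).lt_of_ne' (h.full hf y)) hq₂ hq0 he he1 (h.swap_le hf)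
      rwa [hmix] at h2

end Renyi

section Majorization

/-- Relative majorization: one stochastic matrix maps `a` to `c` and `b` to `d`. -/
def Maj {A B : Type} [Fintype A] [Fintype B] (a b : A → ℝ) (c d : B → ℝ) : Prop :=
  ∃ T : B → A → ℝ, IsStoch T ∧ (∀ y, ∑ x, T y x * a x = c y) ∧ ∀ y, ∑ x, T y x * b x = d y

variable {A B : Type} [Fintype A] [Fintype B]

theorem Maj.refl (a b : A → ℝ) : Maj a b a b :=
  ⟨fun y x => if x = y then 1 else 0,
    ⟨fun y x => by dsimp only; split_ifs <;> simp, by simp⟩, by simp, by simp⟩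

theorem Maj.reindex {A' B' : Type} [Fintype A'] [Fintype B'] {a b : A → ℝ} {c d : B → ℝ}
    (h : Maj a b c d) (e : A' ≃ A) (e' : B' ≃ B) {a' b' : A' → ℝ} {c' d' : B' → ℝ}
    (ha : ∀ x, a' x = a (e x)) (hb : ∀ x, b' x = b (e x))
    (hc : ∀ y, c' y = c (e' y)) (hd : ∀ y, d' y = d (e' y)) : Maj a' b' c' d' := by
  obtain ⟨T, hT, h1, h2⟩ := h
  refine ⟨fun y x => T (e' y) (e x), ⟨fun y x => hT.1 _ _, fun x => ?_⟩, fun y => ?_, fun y => ?_⟩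
  · rw [e'.sum_comp fun y => T y (e x), hT.2]
  · simp_rw [ha]
    rw [e.sum_comp fun x => T (e' y) x * a x, h1, hc]
  · simp_rw [hb]
    rw [e.sum_comp fun x => T (e' y) x * b x, h2, hd]

theorem Maj.of_equiv {a b : A → ℝ} {c d : B → ℝ} (e : A ≃ B) (ha : ∀ x, a x = c (e x))
    (hb : ∀ x, b x = d (e x)) : Maj a b c d :=
  (Maj.refl c d).reindex e (Equiv.refl _) ha hb (fun _ => rfl) fun _ => rfl

theorem Maj.smul {a b : A → ℝ} {c d : B → ℝ} (h : Maj a b c d) (k : ℝ) :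
    Maj (fun x => k * a x) (fun x => k * b x) (fun y => k * c y) (fun y => k * d y) := by
  obtain ⟨T, hT, h1, h2⟩ := h
  refine ⟨T, hT, fun y => ?_, fun y => ?_⟩
  · dsimp only; rw [← h1, Finset.mul_sum]; exact Finset.sum_congr rfl fun x _ => by ring
  · dsimp only; rw [← h2, Finset.mul_sum]; exact Finset.sum_congr rfl fun x _ => by ring

theorem Maj.sigma {K : Type} [Fintype K] {S R : K → Type} [∀ k, Fintype (S k)]
    [∀ k, Fintype (R k)] {a b : (Σ k, S k) → ℝ} {c d : (Σ k, R k) → ℝ}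
    (h : ∀ k, Maj (fun s => a ⟨k, s⟩) (fun s => b ⟨k, s⟩) (fun r => c ⟨k, r⟩)
      (fun r => d ⟨k, r⟩)) : Maj a b c d := by
  choose T hT h1 h2 using h
  let M : (Σ k, R k) → (Σ k, S k) → ℝ := fun y x =>
    if h : y.1 = x.1 then T x.1 (h ▸ y.2) x.2 else 0
  have hM : ∀ k r s, M ⟨k, r⟩ ⟨k, s⟩ = T k r s := fun k r s => by simp [M]
  have hM0 : ∀ k k' r s, k ≠ k' → M ⟨k, r⟩ ⟨k', s⟩ = 0 := fun k k' r s hk => by simp [M, hk]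
  have hsum : ∀ (v : (Σ k, S k) → ℝ) k r,
      ∑ x, M ⟨k, r⟩ x * v x = ∑ s, T k r s * v ⟨k, s⟩ := fun v k r => by
    rw [Fintype.sum_sigma, Finset.sum_eq_single k]
    · simp_rw [hM]
    · intro k' _ hk
      exact Finset.sum_eq_zero fun s _ => by rw [hM0 k k' r s hk.symm, zero_mul]
    · simp
  refine ⟨M, ⟨fun y x => ?_, ?_⟩, ?_, ?_⟩
  · simp only [M]
    split_ifs
    · exact (hT _).1 _ _
    · exact le_rfl
  · rintro ⟨k, s⟩
    rw [Fintype.sum_sigma, Finset.sum_eq_single k]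
    · simp_rw [hM]; exact (hT k).2 s
    · intro k' _ hk
      exact Finset.sum_eq_zero fun r _ => hM0 k' k r s hk
    · simp
  · rintro ⟨k, r⟩; rw [hsum, h1]
  · rintro ⟨k, r⟩; rw [hsum, h2]

end Majorization

section Catalyst
variable {I J : Type} [Fintype I] [Fintype J]

theorem maj_block_shift (κ : ℝ) {k l m m' : ℕ} (hl : l = k + 1) (hm : m' = m + 1)
    (p₁ p₂ : I → ℝ) (q₁ q₂ : J → ℝ) :
    Maj (fun x : ((Fin l → J) × (Fin m → I)) × I =>
        κ * ((∏ j, q₁ (x.1.1 j)) * ∏ j, p₁ (x.1.2 j)) * p₁ x.2)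
      (fun x => κ * ((∏ j, q₂ (x.1.1 j)) * ∏ j, p₂ (x.1.2 j)) * p₂ x.2)
      (fun y : ((Fin k → J) × (Fin m' → I)) × J =>
        κ * ((∏ j, q₁ (y.1.1 j)) * ∏ j, p₁ (y.1.2 j)) * q₁ y.2)
      (fun y => κ * ((∏ j, q₂ (y.1.1 j)) * ∏ j, p₂ (y.1.2 j)) * q₂ y.2) := by
  subst hl hm
  let e : ((Fin (k + 1) → J) × (Fin m → I)) × I ≃ ((Fin k → J) × (Fin (m + 1) → I)) × J :=
    { toFun := fun x => ((Fin.tail x.1.1, Fin.cons x.2 x.1.2), x.1.1 0)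
      invFun := fun y => ((Fin.cons y.2 y.1.1, Fin.tail y.1.2), y.1.2 0)
      left_inv := fun x => by simp
      right_inv := fun y => by simp }
  refine Maj.of_equiv e (fun x => ?_) (fun x => ?_) <;>
  · simp only [e, Equiv.coe_fn_mk, Fin.prod_univ_succ, Fin.cons_zero, Fin.cons_succ, Fin.tail]
    ring

theorem maj_block_convert (κ : ℝ) {n k l m m' : ℕ} (hl : l = 0) (hm : m = n) (hk : k = n)
    (hm' : m' = 0) {p₁ p₂ : I → ℝ} {q₁ q₂ : J → ℝ}
    (h : Maj (kpow p₁ (n + 1)) (kpow p₂ (n + 1)) (kpow q₁ (n + 1)) (kpow q₂ (n + 1))) :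
    Maj (fun x : ((Fin l → J) × (Fin m → I)) × I =>
        κ * ((∏ j, q₁ (x.1.1 j)) * ∏ j, p₁ (x.1.2 j)) * p₁ x.2)
      (fun x => κ * ((∏ j, q₂ (x.1.1 j)) * ∏ j, p₂ (x.1.2 j)) * p₂ x.2)
      (fun y : ((Fin k → J) × (Fin m' → I)) × J =>
        κ * ((∏ j, q₁ (y.1.1 j)) * ∏ j, p₁ (y.1.2 j)) * q₁ y.2)
      (fun y => κ * ((∏ j, q₂ (y.1.1 j)) * ∏ j, p₂ (y.1.2 j)) * q₂ y.2) := by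
  subst hl hk hm' hm
  let e : ((Fin 0 → J) × (Fin m → I)) × I ≃ (Fin (m + 1) → I) :=
    { toFun := fun x => Fin.cons x.2 x.1.2
      invFun := fun g => ((Fin.elim0, Fin.tail g), g 0)
      left_inv := fun x => Prod.ext (Prod.ext (Subsingleton.elim _ _) (by simp)) (by simp)
      right_inv := fun y => by simp }
  let e' : ((Fin m → J) × (Fin 0 → I)) × J ≃ (Fin (m + 1) → J) :=
    { toFun := fun x => Fin.cons x.2 x.1.1
      invFun := fun g => ((Fin.tail g, Fin.elim0), g 0)
      left_inv := fun x => Prod.ext (Prod.ext (by simp) (Subsingleton.elim _ _)) (by simp)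
      right_inv := fun y => by simp }
  refine (h.smul κ).reindex e e' (fun x => ?_) (fun x => ?_) (fun x => ?_) (fun x => ?_) <;>
  · simp only [e, e', kpow, Equiv.coe_fn_mk, Fin.prod_univ_succ, Fin.cons_zero, Fin.cons_succ,
      Fin.prod_univ_zero]
    ring

theorem maj_catVec (n : ℕ) {p₁ p₂ : I → ℝ} {q₁ q₂ : J → ℝ}
    (h : Maj (kpow p₁ (n + 1)) (kpow p₂ (n + 1)) (kpow q₁ (n + 1)) (kpow q₂ (n + 1))) :
    Maj (kron (catVec n p₁ q₁) p₁) (kron (catVec n p₂ q₂) p₂)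
      (kron (catVec n p₁ q₁) q₁) (kron (catVec n p₂ q₂) q₂) := by
  let X : Fin (n + 1) → Type := fun l => (Fin (l : ℕ) → J) × (Fin (n - (l : ℕ)) → I)
  let v : (p : I → ℝ) → (q : J → ℝ) → (l : Fin (n + 1)) → X l → ℝ := fun p q l x =>
    1 / (n + 1 : ℝ) * ((∏ j, q (x.1 j)) * ∏ j, p (x.2 j))
  have key : Maj
      (fun x : Σ k, X (finRotate (n + 1) k) × I => v p₁ q₁ _ x.2.1 * p₁ x.2.2)
      (fun x => v p₂ q₂ _ x.2.1 * p₂ x.2.2)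
      (fun y : Σ k, X k × J => v p₁ q₁ _ y.2.1 * q₁ y.2.2)
      (fun y => v p₂ q₂ _ y.2.1 * q₂ y.2.2) := by
    refine Maj.sigma fun k => ?_
    rcases (Nat.lt_succ_iff.1 k.2).lt_or_eq with hk | hk
    · have hr : ((finRotate (n + 1) k : Fin (n + 1)) : ℕ) = k + 1 := by
        rw [coe_finRotate_of_ne_last]
        intro hl; rw [hl] at hk; simp at hk
      exact maj_block_shift _ hr (by rw [hr]; omega) p₁ p₂ q₁ q₂
    · have hr : ((finRotate (n + 1) k : Fin (n + 1)) : ℕ) = 0 := by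
        rw [show k = Fin.last n from Fin.ext hk, finRotate_last]; rfl
      exact maj_block_convert _ hr (by rw [hr]; omega) hk (by omega) h
  let e : CatIdx I J n × I ≃ Σ k, X (finRotate (n + 1) k) × I :=
    (Equiv.sigmaProdDistrib X I).trans
      (Equiv.sigmaCongrLeft (β := fun l => X l × I) (finRotate (n + 1))).symm
  have he : ∀ (p : I → ℝ) (q : J → ℝ) x,
      kron (catVec n p q) p x = v p q _ (e x).2.1 * p (e x).2.2 := by
    intro p q x
    obtain ⟨z, rfl⟩ := e.symm.surjective x
    rw [e.apply_symm_apply]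
    rfl
  exact key.reindex e (Equiv.sigmaProdDistrib X J) (he p₁ q₁) (he p₂ q₂) (fun _ => rfl)
    (fun _ => rfl)

theorem isProb_catVec (n : ℕ) {p : I → ℝ} {q : J → ℝ} (hp : IsProb p) (hq : IsProb q) :
    IsProb (catVec n p q) := by
  refine ⟨fun x => mul_nonneg (by positivity) (mul_nonneg
    (Finset.prod_nonneg fun _ _ => hq.1 _) (Finset.prod_nonneg fun _ _ => hp.1 _)), ?_⟩
  unfold catVec
  rw [← Finset.mul_sum, Fintype.sum_sigma]
  have : ∀ l : Fin (n + 1), ∑ x : (Fin (l : ℕ) → J) × (Fin (n - (l : ℕ)) → I),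
      (∏ j, q (x.1 j)) * ∏ j, p (x.2 j) = 1 := by
    intro l
    rw [Fintype.sum_prod_type]
    change ∑ f, ∑ g, kpow q _ f * kpow p _ g = 1
    rw [← Fintype.sum_mul_sum, (hq.kpow _).2, (hp.kpow _).2, one_mul]
  rw [Finset.sum_congr rfl fun l _ => this l]
  have : (n : ℝ) + 1 ≠ 0 := by positivity
  simp [this]

theorem CondLS.mono {p₁ p₂ : I → ℝ} {q₁ q₂ : J → ℝ} {extra extra' : (J → ℝ) → Prop}
    (h : CondLS p₁ p₂ q₁ q₂ extra) (himp : ∀ r, extra r → extra' r) :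
    CondLS p₁ p₂ q₁ q₂ extra' := fun ε hε =>
  let ⟨u, w, huw, h1, h2, hx, hN⟩ := h ε hε
  ⟨u, w, huw, h1, h2, himp w hx, hN⟩

theorem CondLS.condCat {p₁ p₂ : I → ℝ} {q₁ q₂ : J → ℝ} {extra : (J → ℝ) → Prop}
    (h : CondLS p₁ p₂ q₁ q₂ extra) (hp₁ : IsProb p₁) (hp₂ : IsProb p₂) (hp0 : ∀ x, p₂ x ≠ 0) :
    CondCat p₁ p₂ q₁ q₂ extra := by
  intro ε hε
  obtain ⟨u, w, huw, h1, h2, hx, N, hN⟩ := h ε hε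
  have hcat : ∀ n ≥ N, Maj (kron (catVec n p₁ u) p₁) (kron (catVec n p₂ w) p₂)
      (kron (catVec n p₁ u) u) (kron (catVec n p₂ w) w) := fun n hn =>
    maj_catVec n (hN (n + 1) (by omega))
  refine ⟨u, w, huw, h1, h2, hx, ⟨CatIdx I J N, inferInstance, catVec N p₁ u, catVec N p₂ w,
    ⟨isProb_catVec N hp₁ huw.1, isProb_catVec N hp₂ huw.2.1, fun x hx => ?_⟩,
    hcat N le_rfl⟩, N, hcat⟩
  have h3 := left_ne_zero_of_mul (right_ne_zero_of_mul hx)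
  refine mul_ne_zero (by positivity) (mul_ne_zero ?_ ?_)
  · exact Finset.prod_ne_zero_iff.2 fun j hj => huw.2.2 _ (Finset.prod_ne_zero_iff.1 h3 j hj)
  · exact Finset.prod_ne_zero_iff.2 fun j _ => hp0 _

end Catalyst

theorem kron_nonneg {I J : Type} {a : I → ℝ} {b : J → ℝ} (ha : ∀ x, 0 ≤ a x) (hb : ∀ x, 0 ≤ b x) (x : I × J) :
    0 ≤ kron a b x := mul_nonneg (ha _) (hb _)

section Necessity
variable {I J R : Type} [Fintype I] [Fintype J] [Fintype R]

theorem sum_kron (a : I → ℝ) (b : J → ℝ) : ∑ x, kron a b x = (∑ x, a x) * ∑ y, b y := by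
  rw [Fintype.sum_mul_sum, Fintype.sum_prod_type]; rfl

theorem rsum_ge_of_catalytic {p₁ p₂ : I → ℝ} {u w : J → ℝ} {r₁ r₂ : R → ℝ}
    (hp₁ : ∀ x, 0 ≤ p₁ x) (hp₂ : ∀ x, 0 ≤ p₂ x) (hu : ∀ x, 0 ≤ u x) (hw : ∀ x, 0 ≤ w x)
    (hr₁ : ∀ x, 0 ≤ r₁ x) (hr₂ : ∀ x, 0 ≤ r₂ x) (hr : ∃ s, r₁ s ≠ 0 ∧ r₂ s ≠ 0)
    (h : Maj (kron r₁ p₁) (kron r₂ p₂) (kron r₁ u) (kron r₂ w)) {β : ℝ} (h0 : 0 < β)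
    (h1 : β < 1) : rsum β p₁ p₂ ≤ rsum β u w := by
  obtain ⟨T, hT, e1, e2⟩ := h
  have := rsum_ge_of_stoch hT (kron_nonneg hr₁ hp₁) (kron_nonneg hr₂ hp₂) h0 h1
  simp_rw [e1, e2] at this
  rw [rsum_kron hr₁ hr₂ hp₁ hp₂, rsum_kron hr₁ hr₂ hu hw] at this
  exact le_of_mul_le_mul_left this (rsum_pos hr₁ hr₂ hr β)

theorem rsum_le_of_catalytic {p₁ p₂ : I → ℝ} {u w : J → ℝ} {r₁ r₂ : R → ℝ}
    (hp₁ : ∀ x, 0 ≤ p₁ x) (hp₂ : ∀ x, 0 < p₂ x) (hu : ∀ x, 0 ≤ u x) (hw : ∀ x, 0 ≤ w x)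
    (hr₁ : ∀ x, 0 ≤ r₁ x) (hr₂ : ∀ x, 0 ≤ r₂ x) (hr : ∃ s, r₁ s ≠ 0 ∧ r₂ s ≠ 0)
    (hr0 : ∀ s, r₂ s = 0 → r₁ s = 0)
    (h : Maj (kron r₁ p₁) (kron r₂ p₂) (kron r₁ u) (kron r₂ w)) {β : ℝ} (h1 : 1 < β) :
    rsum β u w ≤ rsum β p₁ p₂ := by
  obtain ⟨T, hT, e1, e2⟩ := h
  have hp₂' : ∀ x, 0 ≤ p₂ x := fun x => (hp₂ x).le
  have := rsum_le_of_stoch hT (kron_nonneg hr₁ hp₁) (kron_nonneg hr₂ hp₂') (fun x hx => by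
    unfold kron at *
    rw [hr0 _ ((mul_eq_zero.1 hx).resolve_right (hp₂ _).ne'), zero_mul]) h1
  simp_rw [e1, e2] at this
  rw [rsum_kron hr₁ hr₂ hp₁ hp₂', rsum_kron hr₁ hr₂ hu hw] at this
  exact le_of_mul_le_mul_left this (rsum_pos hr₁ hr₂ hr β)

/-- When `p₁` has full support, the part of the second catalyst living off the support of the
first one can be discarded. -/
theorem maj_restrict {p₁ p₂ : I → ℝ} {u w : J → ℝ} {r₁ r₂ : R → ℝ}
    (hp₁ : ∀ x, 0 < p₁ x) (hp₂ : IsProb p₂) (hw : IsProb w)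
    (hr₁ : ∀ s, 0 ≤ r₁ s) (hr₂ : ∀ s, 0 ≤ r₂ s)
    (h : Maj (kron r₁ p₁) (kron r₂ p₂) (kron r₁ u) (kron r₂ w)) :
    Maj (kron (fun s => if r₁ s = 0 then 0 else r₂ s) p₂) (kron r₁ p₁)
      (kron (fun s => if r₁ s = 0 then 0 else r₂ s) w) (kron r₁ u) := by
  obtain ⟨T, hT, e1, e2⟩ := h
  set r' : R → ℝ := fun s => if r₁ s = 0 then 0 else r₂ s with hr'
  set r'' : R → ℝ := fun s => if r₁ s = 0 then r₂ s else 0 with hr''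
  have hr''0 : ∀ s, 0 ≤ r'' s := fun s => by simp only [r'']; split_ifs; exacts [hr₂ s, le_rfl]
  have hsplit : ∀ s, r₂ s = r' s + r'' s := fun s => by simp only [r', r'']; split_ifs <;> simp
  have hzero : ∀ y x, kron r₁ u y = 0 → r₁ x.1 ≠ 0 → T y x = 0 := by
    intro y x hy hx
    rw [← e1 y] at hy
    have h2 := (Finset.sum_eq_zero_iff_of_nonneg fun x _ => mul_nonneg (hT.1 y x)
      (kron_nonneg hr₁ (fun x => (hp₁ x).le) x)).1 hy x (Finset.mem_univ x)
    exact (mul_eq_zero.1 h2).resolve_right (mul_ne_zero hx (hp₁ _).ne')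
  have hT' : ∀ y, kron r₁ u y = 0 → ∑ x, T y x * kron r' p₂ x = 0 := by
    refine fun y hy => Finset.sum_eq_zero fun x _ => ?_
    by_cases hx : r₁ x.1 = 0
    · simp [kron, r', hx]
    · rw [hzero y x hy hx, zero_mul]
  have hadd : ∀ y, ∑ x, T y x * kron r' p₂ x + ∑ x, T y x * kron r'' p₂ x = kron r₂ w y := by
    intro y
    rw [← e2, ← Finset.sum_add_distrib]
    exact Finset.sum_congr rfl fun x _ => by simp only [kron, hsplit]; ring
  have hle : ∀ y ∈ Finset.univ, kron r'' w y ≤ ∑ x, T y x * kron r'' p₂ x := by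
    intro y _
    by_cases hy : r₁ y.1 = 0
    · rw [← zero_add (∑ x, T y x * kron r'' p₂ x), ← hT' y (by simp [kron, hy]), hadd]
      simp [kron, r'', hy]
    · have : kron r'' w y = 0 := by simp [kron, r'', hy]
      rw [this]
      exact Finset.sum_nonneg fun x _ => mul_nonneg (hT.1 y x) (kron_nonneg hr''0 hp₂.1 x)
  have hsum : ∑ y, kron r'' w y = ∑ y, ∑ x, T y x * kron r'' p₂ x := by
    rw [Finset.sum_comm, Finset.sum_congr rfl fun x _ => (Finset.sum_mul _ _ _).symm]
    simp_rw [hT.2, one_mul]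
    rw [sum_kron, sum_kron, hw.2, hp₂.2]
  have heq := (Finset.sum_eq_sum_iff_of_le hle).1 hsum
  refine ⟨T, hT, fun y => ?_, e1⟩
  have h1 := hadd y
  rw [← heq y (Finset.mem_univ y)] at h1
  simp only [kron, hsplit] at h1 ⊢
  linarith

theorem swap_rsum_le_of_catalytic {p₁ p₂ : I → ℝ} {u w : J → ℝ} {r₁ r₂ : R → ℝ}
    (hp₁ : ∀ x, 0 < p₁ x) (hp₂ : IsProb p₂) (hu : ∀ x, 0 ≤ u x) (hw : IsProb w)
    (hr₁ : ∀ s, 0 ≤ r₁ s) (hr₂ : ∀ s, 0 ≤ r₂ s) (hr : ∃ s, r₁ s ≠ 0 ∧ r₂ s ≠ 0)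
    (h : Maj (kron r₁ p₁) (kron r₂ p₂) (kron r₁ u) (kron r₂ w)) :
    (∀ y, u y = 0 → w y = 0) ∧ ∀ β, 1 < β → rsum β w u ≤ rsum β p₂ p₁ := by
  have hm := maj_restrict hp₁ hp₂ hw hr₁ hr₂ h
  set r' : R → ℝ := fun s => if r₁ s = 0 then 0 else r₂ s with hr'
  have hr'0 : ∀ s, 0 ≤ r' s := fun s => by simp only [r']; split_ifs; exacts [le_rfl, hr₂ s]
  have hr'1 : ∃ s, r' s ≠ 0 ∧ r₁ s ≠ 0 := hr.imp fun s hs => ⟨by simp [r', hs.1, hs.2], hs.1⟩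
  have hp₁' : ∀ x, 0 ≤ p₁ x := fun x => (hp₁ x).le
  constructor
  · intro y hy
    obtain ⟨T, hT, e1, e2⟩ := hm
    obtain ⟨s, hs, -⟩ := hr'1
    have h1 : ∑ x, T (s, y) x * kron r₁ p₁ x = 0 := by rw [e2]; simp [kron, hy]
    have h2 := (Finset.sum_eq_zero_iff_of_nonneg fun x _ => mul_nonneg (hT.1 (s, y) x)
      (kron_nonneg hr₁ hp₁' x)).1 h1
    have h3 : kron r' w (s, y) = 0 := by
      rw [← e1]
      refine Finset.sum_eq_zero fun x hx => ?_
      by_cases hx1 : r₁ x.1 = 0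
      · simp [kron, r', hx1]
      · rw [(mul_eq_zero.1 (h2 x hx)).resolve_right (mul_ne_zero hx1 (hp₁ _).ne'), zero_mul]
    exact (mul_eq_zero.1 h3).resolve_left hs
  · intro β hβ
    exact rsum_le_of_catalytic hp₂.1 hp₁ hw.1 hu hr'0 hr₁ hr'1
      (fun s hs => by simp [r', hs]) hm hβ

theorem CondCat.rsumDom {p₁ p₂ : I → ℝ} {q₁ q₂ : J → ℝ} {extra : (J → ℝ) → Prop}
    (h : CondCat p₁ p₂ q₁ q₂ extra) (hp₁ : IsProb p₁) (hp₂ : IsProb p₂)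
    (hp0 : ∀ x, 0 < p₂ x) (hq0 : ∀ y, 0 < q₂ y) : RsumDom p₁ p₂ q₁ q₂ := by
  choose u w huw hu hw _ hcat _ using fun k : ℕ => h (1 / (k + 1 : ℝ)) (by positivity)
  have hlim : ∀ {q : J → ℝ} {v : ℕ → J → ℝ}, (∀ k : ℕ, dist1 q (v k) ≤ 1 / (k + 1 : ℝ)) →
      ∀ y, Tendsto (fun k => v k y) atTop (𝓝 (q y)) := by
    intro q v hv y
    rw [tendsto_iff_dist_tendsto_zero]
    refine squeeze_zero (fun _ => dist_nonneg) (fun k => ?_) tendsto_one_div_add_atTop_nhds_zero_nat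
    refine le_trans ?_ (hv k)
    rw [Real.dist_eq, abs_sub_comm]
    exact Finset.single_le_sum (f := fun y => |q y - v k y|) (fun _ _ => abs_nonneg _)
      (Finset.mem_univ y)
  have hu := hlim hu
  have hw := hlim hw
  have hu0 : ∀ k y, 0 ≤ u k y := fun k => (huw k).1.1
  have hw0 : ∀ k y, 0 ≤ w k y := fun k => (huw k).2.1.1
  have hex : ∀ {R : Type} [Fintype R] {r₁ r₂ : R → ℝ}, IsDichotomy r₁ r₂ →
      ∃ s, r₁ s ≠ 0 ∧ r₂ s ≠ 0 := fun hr =>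
    hr.1.exists_ne_zero.imp fun s hs => ⟨hs, hr.2.2 s hs⟩
  have hswap : (∀ x, p₁ x ≠ 0) → ∀ k, (∀ y, u k y = 0 → w k y = 0) ∧
      ∀ β, 1 < β → rsum β (w k) (u k) ≤ rsum β p₂ p₁ := by
    intro hf k
    obtain ⟨R, _, r₁, r₂, hr, hm⟩ := hcat k
    exact swap_rsum_le_of_catalytic (fun x => (hp₁.1 x).lt_of_ne' (hf x)) hp₂ (hu0 k) (huw k).2.1
      hr.1.1 hr.2.1.1 (hex hr) hm
  have hfull : (∀ x, p₁ x ≠ 0) → ∀ y, q₁ y ≠ 0 := by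
    intro hf y hy
    have h1 : ∀ k, w k y ^ (2 : ℝ) ≤ rsum 2 p₂ p₁ * u k y := by
      intro k
      rcases (hu0 k y).eq_or_lt with h0 | h0
      · rw [(hswap hf k).1 y h0.symm, ← h0]; simp
      · have h2 := (Finset.single_le_sum (f := fun y => w k y ^ (2 : ℝ) * u k y ^ (1 - 2 : ℝ))
          (fun y _ => rpow_mul_rpow_nonneg (hw0 k y) (hu0 k y) 2) (Finset.mem_univ y)).trans
          ((hswap hf k).2 2 one_lt_two)
        have e1 : (1 - 2 : ℝ) = -1 := by norm_num
        rwa [e1, Real.rpow_neg_one, ← div_eq_mul_inv, div_le_iff₀ h0] at h2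
    have h2 := le_of_tendsto_of_tendsto' ((hw y).rpow_const (Or.inr zero_le_two))
      ((hu y).const_mul _) h1
    rw [hy, mul_zero] at h2
    exact h2.not_gt (Real.rpow_pos_of_pos (hq0 y) _)
  refine ⟨fun β h0 h1 => ?_, fun β h1 => ?_, hfull, fun hf β h1 => ?_⟩
  · refine ge_of_tendsto' (x := atTop) (f := fun k => rsum β (u k) (w k)) (tendsto_finsetSum _
      fun y _ => ((hu y).rpow_const (Or.inr h0.le)).mul
        ((hw y).rpow_const (Or.inl (hq0 y).ne'))) fun k => ?_
    obtain ⟨R, _, r₁, r₂, hr, hm⟩ := hcat k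
    exact rsum_ge_of_catalytic hp₁.1 hp₂.1 (hu0 k) (hw0 k) hr.1.1 hr.2.1.1 (hex hr) hm h0 h1
  · refine le_of_tendsto' (x := atTop) (f := fun k => rsum β (u k) (w k)) (tendsto_finsetSum _
      fun y _ => ((hu y).rpow_const (Or.inr (by linarith))).mul
        ((hw y).rpow_const (Or.inl (hq0 y).ne'))) fun k => ?_
    obtain ⟨R, _, r₁, r₂, hr, hm⟩ := hcat k
    exact rsum_le_of_catalytic hp₁.1 hp0 (hu0 k) (hw0 k) hr.1.1 hr.2.1.1 (hex hr)
      (fun s hs => by_contra fun hne => hr.2.2 s hne hs) hm h1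
  · exact le_of_tendsto' (x := atTop) (f := fun k => rsum β (w k) (u k)) (tendsto_finsetSum _
      fun y _ => ((hw y).rpow_const (Or.inr (by linarith))).mul
        ((hu y).rpow_const (Or.inl (hfull hf y)))) fun k => (hswap hf k).2 β h1

end Necessity

end Helpers

/-- asymptotic regime, full-support second components.  Let
`p₁, p₂, q₁, q₂` be probability vectors on `n` points, with `p₂, q₂` of full support
and `p₁ ≠ p₂`.  Then the Rényi-divergence inequalities in both directions for all
`α ≥ 1/2`, approximate catalytic majorization, and approximate large-sample
majorization are equivalent; moreover in the approximate conditions one may keep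
`qε₂ = q₂` exactly. -/
theorem stmt18 (n : ℕ) (p₁ p₂ q₁ q₂ : Fin n → ℝ)
    (hp₁ : IsProb p₁) (hp₂ : IsProb p₂) (hq₁ : IsProb q₁) (hq₂ : IsProb q₂)
    (hp₂full : ∀ x, p₂ x ≠ 0) (hq₂full : ∀ x, q₂ x ≠ 0)
    (hne : p₁ ≠ p₂) :
    ((∀ α : ℝ, 1 / 2 ≤ α →
        renyi α q₁ q₂ ≤ renyi α p₁ p₂ ∧ renyi α q₂ q₁ ≤ renyi α p₂ p₁) ↔
      CondCat p₁ p₂ q₁ q₂ (fun _ => True)) ∧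
    ((∀ α : ℝ, 1 / 2 ≤ α →
        renyi α q₁ q₂ ≤ renyi α p₁ p₂ ∧ renyi α q₂ q₁ ≤ renyi α p₂ p₁) ↔
      CondLS p₁ p₂ q₁ q₂ (fun _ => True)) ∧
    ((∀ α : ℝ, 1 / 2 ≤ α →
        renyi α q₁ q₂ ≤ renyi α p₁ p₂ ∧ renyi α q₂ q₁ ≤ renyi α p₂ p₁) →
      CondCat p₁ p₂ q₁ q₂ (fun r => r = q₂) ∧ CondLS p₁ p₂ q₁ q₂ (fun r => r = q₂)) := by
  have hp0 : ∀ x, 0 < p₂ x := fun x => (hp₂.1 x).lt_of_ne' (hp₂full x)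
  have hq0 : ∀ x, 0 < q₂ x := fun x => (hq₂.1 x).lt_of_ne' (hq₂full x)
  rw [rsumDom_iff_renyi_le hp₁ hp₂ hq₁ hq₂ hp0 hq0]
  have hls : RsumDom p₁ p₂ q₁ q₂ → CondLS p₁ p₂ q₁ q₂ (fun r => r = q₂) := fun h =>
    h.condLS hp₁ hp₂ hq₁ hq₂ hp0 hq0 hne
  have hls' : RsumDom p₁ p₂ q₁ q₂ → CondLS p₁ p₂ q₁ q₂ (fun _ => True) := fun h =>
    (hls h).mono fun _ _ => trivial
  exact ⟨⟨fun h => (hls' h).condCat hp₁ hp₂ hp₂full, fun h => h.rsumDom hp₁ hp₂ hp0 hq0⟩,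
    ⟨hls', fun h => (h.condCat hp₁ hp₂ hp₂full).rsumDom hp₁ hp₂ hp0 hq0⟩,
    fun h => ⟨(hls h).condCat hp₁ hp₂ hp₂full, hls h⟩⟩
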